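/- Let p be an odd prime. Assume that n is not of the form 2p^k with k ≥ 1, and that it is not the case that p = 3 and n = 5·3^k for some k ≥ 0. Let J be the radical of the ideal pO, i.e., the product of all maximal ideals of O lying over p. Then the reduction map mod J sends Δ onto all of SL₂(O/J); equivalently, Δ surjects onto the direct product of SL₂(O/𝔭) over all maximal ideals 𝔭 of O lying over p. -/

import Mathlib

open Matrix
open scoped MatrixGroups

set_option synthInstance.maxHeartbeats 1000000
set_option maxHeartbeats 1000000

noncomputable section

/-- The ring `O = ℤ[ζ + ζ⁻¹]`, realized as a subalgebra of `ℂ`. -/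
abbrev Oring (ζ : ℂ) : Subalgebra ℤ ℂ := Algebra.adjoin ℤ {ζ + ζ⁻¹}

/-- The element `ζ + ζ⁻¹` of `O`. -/
def lamO (ζ : ℂ) : Oring ζ := ⟨ζ + ζ⁻¹, Algebra.subset_adjoin rfl⟩

/-- The matrix `T = [[1, 2 + ζ + ζ⁻¹], [0, 1]]` in `SL₂(O)`. -/
def Tmat (ζ : ℂ) : SL(2, Oring ζ) :=
  ⟨!![1, 2 + lamO ζ; 0, 1], by rw [Matrix.det_fin_two_of]; ring⟩

/-- The matrix `U = [[-1, 0], [1, -1]]` in `SL₂(O)`. -/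
def Umat (ζ : ℂ) : SL(2, Oring ζ) :=
  ⟨!![-1, 0; 1, -1], by rw [Matrix.det_fin_two_of]; ring⟩

/-- The matrix `R = U * T` in `SL₂(O)`. -/
def Rmat (ζ : ℂ) : SL(2, Oring ζ) := Umat ζ * Tmat ζ

/-- The triangle group `Δ = ⟨T, U⟩ ⊆ SL₂(O)`. -/
def Delta (ζ : ℂ) : Subgroup SL(2, Oring ζ) := Subgroup.closure {Tmat ζ, Umat ζ}

/-- Reduction mod the ideal `J`: the natural map `SL₂(O) → SL₂(O/J)`. -/
def SLred (ζ : ℂ) (J : Ideal (Oring ζ)) : SL(2, Oring ζ) →* SL(2, Oring ζ ⧸ J) :=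
  Matrix.SpecialLinearGroup.map (Ideal.Quotient.mk J)


/-- Sum of a polynomial of small degree over a finite additive subgroup. -/
theorem sum_addSubgroup_eq {F : Type*} [Field F] [Finite F] (V : AddSubgroup F) [Fintype V] :
    ∃ κ : F, ∀ f : Polynomial F, f.degree < (Fintype.card V : ℕ) →
      ∑ v : V, f.eval (v : F) = κ * f.coeff (Fintype.card V - 1) := by
  classical
  set κ : F := ∏ w ∈ Finset.univ.erase (0 : V), ((0 : V) - w : F) with hκ
  have hinj : Set.InjOn (fun v : V => (v : F)) (Finset.univ : Finset V) :=
    fun a _ b _ h => Subtype.ext h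
  have hprod : ∀ v : V, ∏ w ∈ Finset.univ.erase v, ((v : F) - w) = κ := by
    intro v
    rw [hκ]
    refine Finset.prod_bij (fun w _ => w - v) ?_ ?_ ?_ ?_
    · intro w hw
      simp only [Finset.mem_erase, Finset.mem_univ, and_true] at hw ⊢
      exact sub_ne_zero.mpr hw
    · intro a _ b _ h
      exact sub_left_injective h
    · intro w hw
      simp only [Finset.mem_erase, Finset.mem_univ, and_true] at hw
      exact ⟨w + v, by simpa using hw, by simp⟩
    · intro w hw
      simp
  have hκ0 : κ ≠ 0 := by
    rw [hκ]
    refine Finset.prod_ne_zero_iff.mpr ?_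
    intro w hw
    simp only [Finset.mem_erase, Finset.mem_univ, and_true] at hw
    simpa using hw
  refine ⟨κ, fun f hf => ?_⟩
  have h := Lagrange.coeff_eq_sum (s := (Finset.univ : Finset V)) (v := fun v : V => (v : F)) hinj
    (P := f) (by simpa using hf)
  rw [Finset.card_univ] at h
  rw [h, Finset.mul_sum]
  refine Finset.sum_congr rfl fun v _ => ?_
  rw [hprod v]
  field_simp

theorem sum_free_orbits {P Y F ι : Type*} [Group P] [Fintype P] [MulAction P Y] [Fintype Y]
    [Field F] (y0 : Y) (hy0 : ∀ u : P, u • y0 = y0)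
    (hfree : ∀ y, y ≠ y0 → ∀ u : P, u • y = y → u = 1)
    (Φ : ι → Y → F) (k : Y → F) (ψ : ι → F)
    (hsum : ∀ x y, ∑ u : P, Φ x (u • y) = k y * ψ x) :
    ∃ c : F, ∀ x, ∑ y, Φ x y = Φ x y0 + c * ψ x := by
  classical
  let S : Finset Y := Finset.univ.erase y0
  let q : Y → MulAction.orbitRel.Quotient P Y := fun y => Quotient.mk'' y
  let T := S.image q
  have key : ∀ x, ∀ ω ∈ T, ∑ y ∈ S with q y = ω, Φ x y = k ω.out * ψ x := by
    intro x ω hω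
    obtain ⟨y, hy, rfl⟩ := Finset.mem_image.mp hω
    have hyn : y ≠ y0 := (Finset.mem_erase.mp hy).1
    set z := (q y).out with hz
    have hqz : q z = q y := Quotient.out_eq' _
    have hzrel : ∀ w, q w = q z ↔ ∃ u : P, u • z = w := by
      intro w
      rw [Quotient.eq'', MulAction.orbitRel_apply, MulAction.mem_orbit_iff]
    have hzn : z ≠ y0 := by
      intro h
      obtain ⟨u, hu⟩ := (hzrel y).1 hqz.symm
      rw [h, hy0] at hu
      exact hyn hu.symm
    rw [← hsum x z]
    symm
    refine Finset.sum_bij (fun u _ => u • z) ?_ ?_ ?_ ?_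
    · intro u _
      simp only [S, Finset.mem_filter, Finset.mem_erase, Finset.mem_univ, and_true]
      refine ⟨?_, ?_⟩
      · intro h
        apply hzn
        rw [← hy0 u] at h
        exact (MulAction.injective u h)
      · rw [← hqz]; exact (hzrel _).2 ⟨u, rfl⟩
    · intro u _ v _ h
      have : (v⁻¹ * u) • z = z := by
        rw [mul_smul]
        rw [show u • z = v • z from h, inv_smul_smul]
      have := hfree z hzn _ this
      rw [inv_mul_eq_one] at this
      exact this.symm
    · intro w hw
      simp only [S, Finset.mem_filter, Finset.mem_erase, Finset.mem_univ, and_true] at hw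
      obtain ⟨u, hu⟩ := (hzrel w).1 (hw.2.trans hqz.symm)
      exact ⟨u, Finset.mem_univ _, hu⟩
    · intros; rfl
  refine ⟨∑ ω ∈ T, k ω.out, fun x => ?_⟩
  rw [← Finset.add_sum_erase Finset.univ _ (Finset.mem_univ y0), Finset.sum_mul]
  congr 1
  rw [← Finset.sum_fiberwise_of_maps_to (s := S) (t := T) (g := q)
    (fun i hi => Finset.mem_image_of_mem _ hi)]
  exact Finset.sum_congr rfl (key x)

theorem transfer_lemma {G X F : Type*} [Group G] [Finite G] [Field F]
    (act : G → X → X) (hact1 : ∀ x, act 1 x = x) (hact : ∀ g h x, act (g * h) x = act g (act h x))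
    (N P : Subgroup G) [Fintype P] (hPN : P ≤ N)
    (hfree : ∀ u ∈ P, ∀ g, g ∉ N → g⁻¹ * u * g ∈ N → u = 1)
    (f : X → F) (hf : ∀ n ∈ N, ∀ x, f (act n x) = f x)
    (ψ : X → F) (k : G → F)
    (hsum : ∀ g x, ∑ u : P, f (act g (act u x)) = k g * ψ x) :
    ∃ c : F, ∀ h x, f (act h x) + c * ψ (act h x) = f x + c * ψ x := by
  classical
  have := Fintype.ofFinite G
  have := Fintype.ofFinite (G ⧸ N)
  let Φ : X → G ⧸ N → F := fun x => Quotient.lift (fun g => f (act g⁻¹ x)) (by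
    intro a b hab
    have hab' : a⁻¹ * b ∈ N := QuotientGroup.leftRel_apply.mp hab
    have : f (act (a⁻¹ * b) (act b⁻¹ x)) = f (act b⁻¹ x) := hf _ hab' _
    rw [← hact] at this
    simpa using this)
  have hΦ : ∀ x (g : G), Φ x (g : G ⧸ N) = f (act g⁻¹ x) := fun _ _ => rfl
  have hS : ∀ h x, ∑ c, Φ (act h x) c = ∑ c, Φ x c := by
    intro h x
    rw [← Equiv.sum_comp (MulAction.toPerm h : Equiv.Perm (G ⧸ N))]
    refine Finset.sum_congr rfl fun c _ => ?_
    induction c using QuotientGroup.induction_on with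
    | H g =>
      rw [MulAction.toPerm_apply, MulAction.Quotient.smul_coe, hΦ, hΦ, smul_eq_mul, ← hact]
      simp
  have hsm : ∀ (u : P) (g : G), (u • (g : G ⧸ N)) = (((u : G) * g : G) : G ⧸ N) := fun _ _ => rfl
  obtain ⟨c, hc⟩ := sum_free_orbits (P := P) (Y := G ⧸ N) (F := F) ((1 : G) : G ⧸ N)
    (by
      intro u
      rw [hsm, mul_one]
      rw [eq_comm, QuotientGroup.eq]
      simpa using hPN u.2)
    (by
      intro y hy u hu
      induction y using QuotientGroup.induction_on with
      | H g =>
        rw [hsm, eq_comm,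
          QuotientGroup.eq, ← mul_assoc] at hu
        have hg : g ∉ N := by
          intro h
          apply hy
          rw [eq_comm, QuotientGroup.eq]
          simpa using h
        exact Subtype.ext (hfree u u.2 g hg hu))
    Φ (fun y => k (y.out)⁻¹) ψ (by
      intro x y
      rw [← hsum]
      conv_lhs => rw [← Equiv.sum_comp (Equiv.inv P)]
      refine Finset.sum_congr rfl fun u _ => ?_
      conv_lhs => rw [← QuotientGroup.out_eq' y]
      rw [hsm, hΦ, ← hact]
      simp)
  refine ⟨c, fun h x => ?_⟩
  have h1 := hc (act h x)
  have h2 := hc x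
  rw [hS, h2] at h1
  rw [hΦ, hΦ] at h1
  simp only [inv_one, hact1] at h1
  exact h1.symm

/-- Upper elementary matrix. -/
def Em {R : Type*} [CommRing R] (x : R) : SL(2, R) :=
  ⟨!![1, x; 0, 1], by rw [Matrix.det_fin_two_of]; ring⟩

/-- Lower elementary matrix. -/
def Lm {R : Type*} [CommRing R] (x : R) : SL(2, R) :=
  ⟨!![1, 0; x, 1], by rw [Matrix.det_fin_two_of]; ring⟩

section entries
variable {R : Type*} [CommRing R]

@[simp] theorem Em_00 (x : R) : (Em x) 0 0 = 1 := rfl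
@[simp] theorem Em_01 (x : R) : (Em x) 0 1 = x := rfl
@[simp] theorem Em_10 (x : R) : (Em x) 1 0 = 0 := rfl
@[simp] theorem Em_11 (x : R) : (Em x) 1 1 = 1 := rfl
@[simp] theorem Lm_00 (x : R) : (Lm x) 0 0 = 1 := rfl
@[simp] theorem Lm_01 (x : R) : (Lm x) 0 1 = 0 := rfl
@[simp] theorem Lm_10 (x : R) : (Lm x) 1 0 = x := rfl
@[simp] theorem Lm_11 (x : R) : (Lm x) 1 1 = 1 := rfl

theorem sl_mul (g h : SL(2, R)) (i j : Fin 2) :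
    (g * h) i j = g i 0 * h 0 j + g i 1 * h 1 j := by
  change (g.1 * h.1) i j = _
  rw [Matrix.mul_apply, Fin.sum_univ_two]

theorem sl_inv (g : SL(2, R)) : g⁻¹ 0 0 = g 1 1 ∧ g⁻¹ 0 1 = - g 0 1 ∧ g⁻¹ 1 0 = - g 1 0 ∧
    g⁻¹ 1 1 = g 0 0 := by
  have : g⁻¹.1 = !![g 1 1, - g 0 1; - g 1 0, g 0 0] := by
    rw [Matrix.SpecialLinearGroup.SL2_inv_expl]; rfl
  refine ⟨?_, ?_, ?_, ?_⟩ <;> (change g⁻¹.1 _ _ = _; rw [this]; rfl)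

theorem sl_det (g : SL(2, R)) : g 0 0 * g 1 1 - g 0 1 * g 1 0 = 1 := by
  have := g.2
  rw [Matrix.det_fin_two] at this
  exact this

theorem sl_ext {g h : SL(2, R)} (h00 : g 0 0 = h 0 0) (h01 : g 0 1 = h 0 1)
    (h10 : g 1 0 = h 1 0) (h11 : g 1 1 = h 1 1) : g = h := by
  ext i j
  fin_cases i <;> fin_cases j <;> assumption

@[simp] theorem sl_one00 : (1 : SL(2, R)) 0 0 = 1 := rfl
@[simp] theorem sl_one01 : (1 : SL(2, R)) 0 1 = 0 := rfl
@[simp] theorem sl_one10 : (1 : SL(2, R)) 1 0 = 0 := rfl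
@[simp] theorem sl_one11 : (1 : SL(2, R)) 1 1 = 1 := rfl

theorem Em_add (x y : R) : Em (x + y) = Em x * Em y := by
  apply sl_ext <;> simp [sl_mul] <;> ring

theorem Lm_add (x y : R) : Lm (x + y) = Lm x * Lm y := by
  apply sl_ext <;> simp [sl_mul]

theorem Em_zero : Em (0 : R) = 1 := by apply sl_ext <;> simp

theorem Lm_zero : Lm (0 : R) = 1 := by apply sl_ext <;> simp

theorem Em_neg (x : R) : Em (-x) = (Em x)⁻¹ := by
  rw [eq_inv_iff_mul_eq_one, ← Em_add, neg_add_cancel, Em_zero]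

theorem Lm_neg (x : R) : Lm (-x) = (Lm x)⁻¹ := by
  rw [eq_inv_iff_mul_eq_one, ← Lm_add, neg_add_cancel, Lm_zero]

/-- the diagonal action -/
def act4 (σ : R →+* R) (g : SL(2, R)) (X : R × R × R × R) : R × R × R × R :=
  (g 0 0 * X.1 + g 0 1 * X.2.1, g 1 0 * X.1 + g 1 1 * X.2.1,
    σ (g 0 0) * X.2.2.1 + σ (g 0 1) * X.2.2.2, σ (g 1 0) * X.2.2.1 + σ (g 1 1) * X.2.2.2)

end entries

section field
variable {F : Type*} [Field F] [Finite F]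

theorem sl2_transfer (G : Subgroup SL(2, F)) (V : AddSubgroup F) [Fintype V]
    (hV : ∀ v, v ∈ V ↔ Em v ∈ G) (σ : F →+* F) (f ψ : F × F × F × F → F) (k : SL(2, F) → F)
    (hf : ∀ n ∈ G, n 1 0 = 0 → ∀ x, f (act4 σ n x) = f x)
    (hsum : ∀ g ∈ G, ∀ x, ∑ v : V, f (act4 σ g (act4 σ (Em (v : F)) x)) = k g * ψ x) :
    ∃ c : F, ∀ h ∈ G, ∀ x, f (act4 σ h x) + c * ψ (act4 σ h x) = f x + c * ψ x := by
  classical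
  let N : Subgroup G :=
    { carrier := {g | (g : SL(2, F)) 1 0 = 0}
      one_mem' := by simp
      mul_mem' := by
        intro a b ha hb
        simp only [Set.mem_ofPred_eq] at *
        simp [sl_mul, ha, hb]
      inv_mem' := by
        intro a ha
        simp only [Set.mem_ofPred_eq] at *
        rw [Subgroup.coe_inv, (sl_inv _).2.2.1, ha, neg_zero] }
  let ι : Multiplicative V →* G :=
    { toFun := fun v => ⟨Em (v.toAdd : F), (hV _).1 v.toAdd.2⟩
      map_one' := by
        apply Subtype.ext
        exact Em_zero
      map_mul' := by
        intro a b
        apply Subtype.ext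
        exact Em_add _ _ }
  let P : Subgroup G := ι.range
  have := Fintype.ofFinite P
  have hιinj : Function.Injective ι := by
    intro a b h
    have h1 : Em (a.toAdd : F) = Em (b.toAdd : F) := congrArg (fun g : G => (g : SL(2, F))) h
    have h2 := congrArg (fun g : SL(2, F) => g 0 1) h1
    simp only [Em_01] at h2
    exact Multiplicative.toAdd.injective (Subtype.ext h2)
  let e : V ≃ P := Multiplicative.ofAdd.trans (MonoidHom.ofInjective hιinj).toEquiv
  have he : ∀ v : V, ((e v : G) : SL(2, F)) = Em (v : F) := fun v => rfl
  have hmain := transfer_lemma (G := G) (X := F × F × F × F) (F := F)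
    (fun g x => act4 σ (g : SL(2, F)) x)
    (by
      rintro ⟨x, y, x', y'⟩
      simp [act4])
    (by
      rintro g h ⟨x, y, x', y'⟩
      simp only [act4, Subgroup.coe_mul, sl_mul, map_add, map_mul, Prod.mk.injEq]
      refine ⟨?_, ?_, ?_, ?_⟩ <;> ring)
    N P
    (by
      rintro _ ⟨v, rfl⟩
      exact Em_10 _)
    (by
      rintro _ ⟨v, rfl⟩ g hg h
      have hg' : (g : SL(2, F)) 1 0 ≠ 0 := hg
      have h' : ((g : SL(2, F))⁻¹ * Em (v.toAdd : F) * (g : SL(2, F))) 1 0 = 0 := h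
      simp only [sl_mul, sl_inv, Em_00, Em_01, Em_10, Em_11] at h'
      have h2 : ((g : SL(2, F)) 1 0) ^ 2 * (v.toAdd : F) = 0 := by linear_combination - h'
      have h3 : (v.toAdd : F) = 0 := by
        rcases mul_eq_zero.mp h2 with h | h
        · exact absurd (pow_eq_zero_iff (two_ne_zero) |>.mp h) hg'
        · exact h
      have : v = 1 := Multiplicative.toAdd.injective (Subtype.ext h3)
      rw [this, map_one])
    f
    (by
      intro n hn x
      exact hf n n.2 hn x)
    ψ (fun g => k g)
    (by
      intro g x
      rw [← hsum g g.2 x, ← Equiv.sum_comp e]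
      rfl)
  obtain ⟨c, hc⟩ := hmain
  exact ⟨c, fun h hh x => hc ⟨h, hh⟩ x⟩

/-- upper unipotent part of a subgroup of `SL₂`. -/
def Vof (G : Subgroup SL(2, F)) : AddSubgroup F where
  carrier := {v | Em v ∈ G}
  zero_mem' := by
    simp only [Set.mem_ofPred_eq, Em_zero]; exact G.one_mem
  add_mem' := by
    intro a b ha hb
    simp only [Set.mem_ofPred_eq] at *
    rw [Em_add]; exact G.mul_mem ha hb
  neg_mem' := by
    intro a ha
    simp only [Set.mem_ofPred_eq] at *
    rw [Em_neg]; exact G.inv_mem ha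

theorem mem_Vof (G : Subgroup SL(2, F)) (v : F) : v ∈ Vof G ↔ Em v ∈ G := Iff.rfl

/-- torus part of a subgroup of `SL₂`. -/
def Hof (G : Subgroup SL(2, F)) : Subgroup Fˣ where
  carrier := {t | ∃ n ∈ G, n 1 0 = 0 ∧ n 0 0 = t}
  one_mem' := ⟨1, G.one_mem, by simp, by simp⟩
  mul_mem' := by
    rintro a b ⟨n, hn, h1, h2⟩ ⟨m, hm, h3, h4⟩
    exact ⟨n * m, G.mul_mem hn hm, by simp [sl_mul, h1, h3], by simp [sl_mul, h2, h3, h4]⟩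
  inv_mem' := by
    rintro a ⟨n, hn, h1, h2⟩
    refine ⟨n⁻¹, G.inv_mem hn, by rw [(sl_inv n).2.2.1, h1, neg_zero], ?_⟩
    rw [(sl_inv n).1]
    have := sl_det n
    rw [h1, h2] at this
    rw [Units.val_inv_eq_inv_val]
    have ha : (a : F) ≠ 0 := a.ne_zero
    field_simp
    linear_combination this

theorem upper_ne (n : SL(2, F)) (h : n 1 0 = 0) : n 0 0 ≠ 0 := by
  intro h0
  have := sl_det n
  rw [h, h0] at this
  simp at this

theorem upper_11 (n : SL(2, F)) (h : n 1 0 = 0) : n 1 1 = (n 0 0)⁻¹ := by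
  have := sl_det n
  rw [h] at this
  have h0 := upper_ne n h
  field_simp
  linear_combination this

theorem mem_Hof_of (G : Subgroup SL(2, F)) (n : SL(2, F)) (hn : n ∈ G) (h : n 1 0 = 0) :
    Units.mk0 (n 0 0) (upper_ne n h) ∈ Hof G := ⟨n, hn, h, rfl⟩

theorem card_le_Hof (G : Subgroup SL(2, F)) (b : F) (hb : b ≠ 0) (hL : Lm b ∈ G) :
    Nat.card (Vof G) - 1 ≤ Nat.card (Hof G) := by
  classical
  have := Fintype.ofFinite (Vof G)
  by_contra hlt
  push Not at hlt
  set s := Nat.card (Hof G) with hs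
  have hs0 : s ≠ 0 := Nat.card_pos.ne'
  rw [Nat.card_eq_fintype_card] at hlt
  obtain ⟨κ, hκ⟩ := sum_addSubgroup_eq (Vof G)
  obtain ⟨c, hc⟩ := sl2_transfer G (Vof G) (mem_Vof G) (RingHom.id F)
    (fun x => x.2.1 ^ s) (fun _ => 0) (fun _ => 0)
    (by
      rintro n hn h ⟨x, y, x', y'⟩
      have h1 : (Units.mk0 (n 0 0) (upper_ne n h)) ^ s = 1 := by
        have := pow_card_eq_one' (x := (⟨_, mem_Hof_of G n hn h⟩ : Hof G))
        exact congrArg Subtype.val this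
      have h2 : (n 0 0) ^ s = 1 := by
        have := congrArg Units.val h1
        simpa using this
      simp only [act4, h, upper_11 n h, zero_mul, zero_add, mul_pow, inv_pow, h2, inv_one, one_mul])
    (by
      rintro g hg ⟨x, y, x', y'⟩
      set pl : Polynomial F := (Polynomial.C (g 1 0 * x + g 1 1 * y) +
        Polynomial.C (g 1 0 * y) * Polynomial.X) ^ s with hpl
      have hdeg : pl.natDegree ≤ s := by
        rw [hpl]
        refine (Polynomial.natDegree_pow_le).trans ?_
        have : (Polynomial.C (g 1 0 * x + g 1 1 * y) +
          Polynomial.C (g 1 0 * y) * Polynomial.X).natDegree ≤ 1 := by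
          compute_degree
        calc s * _ ≤ s * 1 := Nat.mul_le_mul_left _ this
          _ = s := mul_one s
      have h1 := hκ pl (by
        refine lt_of_le_of_lt Polynomial.degree_le_natDegree ?_
        exact_mod_cast lt_of_le_of_lt hdeg (by omega))
      rw [Polynomial.coeff_eq_zero_of_natDegree_lt (by omega), mul_zero] at h1
      rw [zero_mul, ← h1]
      refine Finset.sum_congr rfl fun v _ => ?_
      simp only [act4, hpl, Em_00, Em_01, Em_10, Em_11, Polynomial.eval_pow, Polynomial.eval_add,
        Polynomial.eval_mul, Polynomial.eval_C, Polynomial.eval_X]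
      ring)
  have := hc (Lm b) hL (1, 0, 0, 0)
  simp [act4, hs0, hb] at this

theorem sq_mul_mem (G : Subgroup SL(2, F)) (t : Fˣ) (ht : t ∈ Hof G) (v : F) (hv : v ∈ Vof G) :
    (t : F) ^ 2 * v ∈ Vof G := by
  obtain ⟨n, hn, h, h2⟩ := ht
  have : Em ((t : F) ^ 2 * v) = n * Em v * n⁻¹ := by
    have h11 := upper_11 n h
    have h0 : (t : F) ≠ 0 := t.ne_zero
    rw [h2] at h11
    apply sl_ext <;> simp only [sl_mul, sl_inv, Em_00, Em_01, Em_10, Em_11, h, h11, h2] <;>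
      field_simp <;> ring
  rw [mem_Vof, this]
  exact G.mul_mem (G.mul_mem hn hv) (G.inv_mem hn)

/-- multiplier ring of `V` -/
def Kof (V : AddSubgroup F) : Subring F where
  carrier := {c | ∀ v ∈ V, c * v ∈ V}
  zero_mem' := by intro v _; simp
  one_mem' := by intro v hv; simpa using hv
  add_mem' := by
    intro a b ha hb v hv
    rw [add_mul]; exact V.add_mem (ha v hv) (hb v hv)
  mul_mem' := by
    intro a b ha hb v hv
    rw [mul_assoc]; exact ha _ (hb v hv)
  neg_mem' := by
    intro a ha v hv
    rw [neg_mul]; exact V.neg_mem (ha v hv)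

theorem Kof_eq (G : Subgroup SL(2, F)) (b : F) (hb : b ≠ 0) (hL : Lm b ∈ G) (hE : Em 1 ∈ G)
    : (Kof (Vof G)).toAddSubgroup = Vof G := by
  classical
  have hle : (Kof (Vof G)).toAddSubgroup ≤ Vof G := by
    intro c hc
    have := hc 1 hE
    simpa using this
  have h1 := card_le_Hof G b hb hL
  have hdvd := AddSubgroup.card_dvd_of_le hle
  have h2 : Nat.card (Hof G) ≤ 2 * (Nat.card (Kof (Vof G)).toAddSubgroup - 1) := by
    have := Fintype.ofFinite (Hof G)
    have := Fintype.ofFinite F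
    let S : Finset F := Finset.univ.filter (fun x => x ∈ (Kof (Vof G)) ∧ x ≠ 0)
    let A : Finset (Hof G) := Finset.univ
    have hA : A.card ≤ 2 * (A.image (fun t : Hof G => ((t : Fˣ) : F) ^ 2)).card := by
      refine Finset.card_le_mul_card_image A 2 ?_
      intro y hy
      obtain ⟨t, -, rfl⟩ := Finset.mem_image.mp hy
      have : (A.filter (fun a : Hof G => ((a : Fˣ) : F) ^ 2 = ((t : Fˣ) : F) ^ 2)) ⊆
          A.filter (fun a => a = t ∨ ((a : Fˣ) : F) = -((t : Fˣ) : F)) := by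
        intro a ha
        simp only [Finset.mem_filter] at ha ⊢
        refine ⟨ha.1, ?_⟩
        rcases sq_eq_sq_iff_eq_or_eq_neg.mp ha.2 with h | h
        · left; exact Subtype.ext (Units.ext h)
        · right; exact h
      refine (Finset.card_le_card this).trans ?_
      rw [Finset.filter_or]
      refine (Finset.card_union_le _ _).trans ?_
      have e1 : (A.filter (fun a => a = t)).card ≤ 1 := by
        rw [Finset.card_le_one]
        intro x hx y hy
        simp only [Finset.mem_filter] at hx hy
        rw [hx.2, hy.2]
      have e2 : (A.filter (fun a : Hof G => ((a : Fˣ) : F) = -((t : Fˣ) : F))).card ≤ 1 := by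
        rw [Finset.card_le_one]
        intro x hx y hy
        simp only [Finset.mem_filter] at hx hy
        exact Subtype.ext (Units.ext (hx.2.trans hy.2.symm))
      omega
    have hsub : A.image (fun t : Hof G => ((t : Fˣ) : F) ^ 2) ⊆ S := by
      intro y hy
      obtain ⟨t, -, rfl⟩ := Finset.mem_image.mp hy
      simp only [S, Finset.mem_filter, Finset.mem_univ, true_and]
      exact ⟨fun v hv => sq_mul_mem G t t.2 v hv, pow_ne_zero _ (Units.ne_zero _)⟩
    have hS : S.card = Nat.card (Kof (Vof G)).toAddSubgroup - 1 := by
      have e0 : S = (Finset.univ.filter (fun x => x ∈ (Kof (Vof G)))).erase 0 := by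
        ext x
        simp [S, and_comm]
      rw [e0, Finset.card_erase_of_mem (by simp [(Kof (Vof G)).zero_mem])]
      congr 1
      have : Fintype (Kof (Vof G)).toAddSubgroup := Fintype.ofFinite _
      rw [Nat.card_eq_fintype_card]
      rw [Fintype.card_subtype]
      rfl
    have := Finset.card_le_card hsub
    rw [Nat.card_eq_fintype_card, ← Finset.card_univ]
    rw [hS] at this
    have hA' : (Finset.univ : Finset (Hof G)).card = A.card := rfl
    omega
  have hk : 0 < Nat.card (Kof (Vof G)).toAddSubgroup := Nat.card_pos
  have hk1 : 0 < Nat.card (Vof G) := Nat.card_pos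
  apply AddSubgroup.eq_of_le_of_card_ge hle
  obtain ⟨d, hd⟩ := hdvd
  have : d < 2 := by
    by_contra h
    push Not at h
    have : Nat.card (Kof (Vof G)).toAddSubgroup * 2 ≤ Nat.card (Vof G) := by
      rw [hd]; exact Nat.mul_le_mul_left _ h
    omega
  interval_cases d <;> omega

end field

section field
variable {F : Type*} [Field F] [Finite F]

theorem Kof_iff (G : Subgroup SL(2, F)) (b : F) (hb : b ≠ 0) (hL : Lm b ∈ G) (hE : Em 1 ∈ G)
    (c : F) : c ∈ Kof (Vof G) ↔ c ∈ Vof G := by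
  exact SetLike.ext_iff.mp (Kof_eq G b hb hL hE) c

theorem sq_mem_Kof (G : Subgroup SL(2, F)) (n : SL(2, F)) (hn : n ∈ G) (h : n 1 0 = 0) :
    (n 0 0) ^ 2 ∈ Kof (Vof G) :=
  fun v hv => sq_mul_mem G _ (mem_Hof_of G n hn h) v hv

theorem Kof_inv (V : AddSubgroup F) (c : F) (hc : c ∈ Kof V) : c⁻¹ ∈ Kof V := by
  rcases eq_or_ne c 0 with rfl | h0
  · simpa using hc
  · have := Fintype.ofFinite F
    have h := FiniteField.pow_card_sub_one_eq_one c h0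
    have h2 : c⁻¹ = c ^ (Fintype.card F - 2) := by
      apply inv_eq_of_mul_eq_one_right
      rw [← pow_succ', ← h]
      congr 1
      have := Fintype.one_lt_card (α := F)
      omega
    rw [h2]
    exact (Kof V).pow_mem hc _

theorem exists_complement (G : Subgroup SL(2, F)) (b : F) (hb : b ≠ 0) (hL : Lm b ∈ G)
    (hE : Em 1 ∈ G) (h2 : (2 : F) ≠ 0) :
    ∃ z : F, ∀ n ∈ G, n 1 0 = 0 → n 0 1 * n 0 0 + z * (1 - n 0 0 ^ 2) ∈ Vof G := by
  by_cases hex : ∃ n ∈ G, n 1 0 = 0 ∧ n 0 0 ^ 2 ≠ 1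
  · obtain ⟨m, hm, hm0, hm1⟩ := hex
    have hd : 1 - m 0 0 ^ 2 ≠ 0 := fun h => hm1 (by linear_combination -h)
    refine ⟨- (m 0 1 * m 0 0) / (1 - m 0 0 ^ 2), fun n hn hn0 => ?_⟩
    have hK : (1 - m 0 0 ^ 2)⁻¹ ∈ Kof (Vof G) :=
      Kof_inv _ _ ((Kof _).sub_mem (Kof _).one_mem (sq_mem_Kof G m hm hm0))
    have hm00 := upper_ne m hm0
    have hn00 := upper_ne n hn0
    have hw : n 0 1 * n 0 0 * (1 - m 0 0 ^ 2) - m 0 1 * m 0 0 * (1 - n 0 0 ^ 2) ∈ Vof G := by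
      rw [mem_Vof]
      have : Em (n 0 1 * n 0 0 * (1 - m 0 0 ^ 2) - m 0 1 * m 0 0 * (1 - n 0 0 ^ 2)) =
          n * m * n⁻¹ * m⁻¹ := by
        apply sl_ext <;> simp only [sl_mul, sl_inv, Em_00, Em_01, Em_10, Em_11, hn0, hm0,
          upper_11 n hn0, upper_11 m hm0] <;> field_simp <;> ring
      rw [this]
      exact G.mul_mem (G.mul_mem (G.mul_mem hn hm) (G.inv_mem hn)) (G.inv_mem hm)
    have := hK _ hw
    convert! this using 1
    field_simp
    ring
  · push Not at hex
    refine ⟨0, fun n hn hn0 => ?_⟩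
    have h1 := hex n hn hn0
    have h00 := upper_ne n hn0
    have hK : (2 : F)⁻¹ ∈ Kof (Vof G) := by
      apply Kof_inv
      have := (Kof (Vof G)).add_mem (Kof (Vof G)).one_mem (Kof (Vof G)).one_mem
      rwa [one_add_one_eq_two] at this
    have hw : 2 * (n 0 1 * n 0 0) ∈ Vof G := by
      rw [mem_Vof]
      have : Em (2 * (n 0 1 * n 0 0)) = n * n := by
        apply sl_ext
        · simp only [sl_mul, Em_00, hn0]; linear_combination -h1
        · simp only [sl_mul, Em_01, hn0, upper_11 n hn0]
          field_simp
          linear_combination (2 * (n 0 0 ^ 2 - 1) - n 0 0 ^ 2 + 1) * 0 + n 0 1 * h1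
        · simp only [sl_mul, Em_10, hn0]; ring
        · simp only [sl_mul, Em_11, hn0, upper_11 n hn0]
          field_simp
          linear_combination h1
      rw [this]
      exact G.mul_mem hn hn
    have := hK _ hw
    convert! this using 1
    field_simp
    ring

theorem form_one (G : Subgroup SL(2, F)) (b : F) (hb : b ≠ 0) (hL : Lm b ∈ G)
    (hq : 3 ≤ Nat.card (Vof G)) (σ : F →+* F)
    (hσV : ∀ v ∈ Vof G, σ v = v) (hσH : ∀ n ∈ G, n 1 0 = 0 → σ (n 0 0) = n 0 0)
    (z : F) (hz : ∀ n ∈ G, n 1 0 = 0 → n 0 1 * n 0 0 + z * (1 - n 0 0 ^ 2) ∈ Vof G) :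
    σ b = b := by
  classical
  have := Fintype.ofFinite (Vof G)
  rw [Nat.card_eq_fintype_card] at hq
  obtain ⟨κ, hκ⟩ := sum_addSubgroup_eq (Vof G)
  set c0 := z - σ z with hc0
  obtain ⟨c, hc⟩ := sl2_transfer G (Vof G) (mem_Vof G) σ
    (fun x => x.1 * x.2.2.2 - x.2.1 * x.2.2.1 + c0 * (x.2.1 * x.2.2.2))
    (fun x => x.2.1 * x.2.2.2)
    (fun g => κ * (if Fintype.card (Vof G) - 1 = 2 then
      (g 0 0 * σ (g 1 0) - g 1 0 * σ (g 0 0) + c0 * (g 1 0 * σ (g 1 0))) else 0))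
    (by
      rintro n hn h ⟨x, y, x', y'⟩
      have h1 := hσV _ (hz n hn h)
      have h2 := hσH n hn h
      have h0 := upper_ne n h
      simp only [map_add, map_mul, map_sub, map_one, map_pow, h2] at h1
      simp only [act4, h, upper_11 n h, map_zero, map_inv₀, h2]
      field_simp
      linear_combination (- y * y') * h1)
    (by
      rintro g hg ⟨x, y, x', y'⟩
      set a1 := g 0 0 * x + g 0 1 * y with ha1
      set a2 := g 1 0 * x + g 1 1 * y with ha2
      set b1 := σ (g 0 0) * x' + σ (g 0 1) * y' with hb1
      set b2 := σ (g 1 0) * x' + σ (g 1 1) * y' with hb2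
      set m0 := a1 * b2 - a2 * b1 + c0 * (a2 * b2) with hm0
      set m1 := g 0 0 * y * b2 + a1 * σ (g 1 0) * y' - g 1 0 * y * b1 - a2 * σ (g 0 0) * y'
        + c0 * (g 1 0 * y * b2 + a2 * σ (g 1 0) * y') with hm1
      set m2 := (g 0 0 * σ (g 1 0) - g 1 0 * σ (g 0 0) + c0 * (g 1 0 * σ (g 1 0))) * (y * y')
        with hm2
      set pl : Polynomial F := Polynomial.C m0 + Polynomial.C m1 * Polynomial.X +
        Polynomial.C m2 * Polynomial.X ^ 2 with hpl
      have hdeg : pl.natDegree ≤ 2 := by rw [hpl]; compute_degree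
      have h1 := hκ pl (by
        refine lt_of_le_of_lt Polynomial.degree_le_natDegree ?_
        exact_mod_cast lt_of_le_of_lt hdeg (by omega))
      have hcoeff : pl.coeff (Fintype.card (Vof G) - 1) =
          if Fintype.card (Vof G) - 1 = 2 then m2 else 0 := by
        split_ifs with h
        · rw [h, hpl]; simp [Polynomial.coeff_X, Polynomial.coeff_C]
        · exact Polynomial.coeff_eq_zero_of_natDegree_lt (by omega)
      have hR : κ * (if Fintype.card (Vof G) - 1 = 2 then
          (g 0 0 * σ (g 1 0) - g 1 0 * σ (g 0 0) + c0 * (g 1 0 * σ (g 1 0))) else 0) * (y * y')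
          = κ * pl.coeff (Fintype.card (Vof G) - 1) := by
        rw [hcoeff]
        split_ifs
        · rw [hm2]; ring
        · ring
      simp only
      rw [hR, ← h1]
      refine Finset.sum_congr rfl fun v _ => ?_
      have hv : σ (v : F) = v := hσV _ v.2
      simp only [act4, hpl, Em_00, Em_01, Em_10, Em_11, Polynomial.eval_pow, Polynomial.eval_add,
        Polynomial.eval_mul, Polynomial.eval_C, Polynomial.eval_X, map_one, map_zero, hv,
        hm0, hm1, hm2, ha1, ha2, hb1, hb2]
      ring)
  have e1 := hc (Lm b) hL (1, 0, 1, 0)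
  have e2 := hc (Lm b) hL (1, 0, 0, 1)
  simp only [act4, Lm_00, Lm_01, Lm_10, Lm_11, map_one, map_zero] at e1 e2
  have e3 : (c0 + c) * b = 0 := by linear_combination e2
  have e4 : c0 + c = 0 := (mul_eq_zero.mp e3).resolve_right hb
  linear_combination e1 - b * σ b * e4

theorem form_two (G : Subgroup SL(2, F)) (b : F) (hb : b ≠ 0) (hL : Lm b ∈ G) (htwo : (2 : F) ≠ 0)
    (hq : 5 ≤ Nat.card (Vof G)) (σ : F →+* F)
    (hσV : ∀ v ∈ Vof G, σ v = v)
    (hσH : ∀ n ∈ G, n 1 0 = 0 → σ (n 0 0) = n 0 0 ∨ σ (n 0 0) = - n 0 0)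
    (z : F) (hz : ∀ n ∈ G, n 1 0 = 0 → n 0 1 * n 0 0 + z * (1 - n 0 0 ^ 2) ∈ Vof G) :
    σ b = b := by
  classical
  have := Fintype.ofFinite (Vof G)
  rw [Nat.card_eq_fintype_card] at hq
  obtain ⟨κ, hκ⟩ := sum_addSubgroup_eq (Vof G)
  set c0 := z - σ z with hc0
  obtain ⟨c, hc⟩ := sl2_transfer G (Vof G) (mem_Vof G) σ
    (fun x => (x.1 * x.2.2.2 - x.2.1 * x.2.2.1 + c0 * (x.2.1 * x.2.2.2)) ^ 2)
    (fun x => (x.2.1 * x.2.2.2) ^ 2)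
    (fun g => κ * (if Fintype.card (Vof G) - 1 = 4 then
      (g 0 0 * σ (g 1 0) - g 1 0 * σ (g 0 0) + c0 * (g 1 0 * σ (g 1 0))) ^ 2 else 0))
    (by
      rintro n hn h ⟨x, y, x', y'⟩
      have h1 := hσV _ (hz n hn h)
      have h0 := upper_ne n h
      simp only
      rw [sq_eq_sq_iff_eq_or_eq_neg]
      rcases hσH n hn h with h2 | h2
      · left
        simp only [map_add, map_mul, map_sub, map_one, map_pow, h2] at h1
        simp only [act4, h, upper_11 n h, map_zero, map_inv₀, h2]
        field_simp
        linear_combination (- y * y') * h1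
      · right
        simp only [map_add, map_mul, map_sub, map_one, map_pow, h2] at h1
        simp only [act4, h, upper_11 n h, map_zero, map_inv₀, h2]
        field_simp
        linear_combination (y * y') * h1)
    (by
      rintro g hg ⟨x, y, x', y'⟩
      set a1 := g 0 0 * x + g 0 1 * y with ha1
      set a2 := g 1 0 * x + g 1 1 * y with ha2
      set b1 := σ (g 0 0) * x' + σ (g 0 1) * y' with hb1
      set b2 := σ (g 1 0) * x' + σ (g 1 1) * y' with hb2
      set m0 := a1 * b2 - a2 * b1 + c0 * (a2 * b2) with hm0
      set m1 := g 0 0 * y * b2 + a1 * σ (g 1 0) * y' - g 1 0 * y * b1 - a2 * σ (g 0 0) * y'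
        + c0 * (g 1 0 * y * b2 + a2 * σ (g 1 0) * y') with hm1
      set m2 := (g 0 0 * σ (g 1 0) - g 1 0 * σ (g 0 0) + c0 * (g 1 0 * σ (g 1 0))) * (y * y')
        with hm2
      set pl : Polynomial F := Polynomial.C (m0 ^ 2) + Polynomial.C (2 * m0 * m1) * Polynomial.X +
        Polynomial.C (m1 ^ 2 + 2 * m0 * m2) * Polynomial.X ^ 2 +
        Polynomial.C (2 * m1 * m2) * Polynomial.X ^ 3 + Polynomial.C (m2 ^ 2) * Polynomial.X ^ 4
        with hpl
      have hdeg : pl.natDegree ≤ 4 := by rw [hpl]; compute_degree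
      have h1 := hκ pl (by
        refine lt_of_le_of_lt Polynomial.degree_le_natDegree ?_
        exact_mod_cast lt_of_le_of_lt hdeg (by omega))
      have hcoeff : pl.coeff (Fintype.card (Vof G) - 1) =
          if Fintype.card (Vof G) - 1 = 4 then m2 ^ 2 else 0 := by
        split_ifs with h
        · rw [h, hpl]
          simp only [Polynomial.coeff_add, Polynomial.coeff_C_mul, Polynomial.coeff_X_pow,
            Polynomial.coeff_X, Polynomial.coeff_C]
          simp
        · exact Polynomial.coeff_eq_zero_of_natDegree_lt (by omega)
      have hR : κ * (if Fintype.card (Vof G) - 1 = 4 then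
          (g 0 0 * σ (g 1 0) - g 1 0 * σ (g 0 0) + c0 * (g 1 0 * σ (g 1 0))) ^ 2 else 0)
          * (y * y') ^ 2
          = κ * pl.coeff (Fintype.card (Vof G) - 1) := by
        rw [hcoeff]
        split_ifs
        · rw [hm2]; ring
        · ring
      simp only
      rw [hR, ← h1]
      refine Finset.sum_congr rfl fun v _ => ?_
      have hv : σ (v : F) = v := hσV _ v.2
      have hb : (Polynomial.eval (v : F) pl) = (m0 + m1 * v + m2 * v ^ 2) ^ 2 := by
        simp only [hpl, Polynomial.eval_pow, Polynomial.eval_add,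
          Polynomial.eval_mul, Polynomial.eval_C, Polynomial.eval_X]
        ring
      rw [hb]
      congr 1
      simp only [act4, Em_00, Em_01, Em_10, Em_11, map_one, map_zero, hv,
        hm0, hm1, hm2, ha1, ha2, hb1, hb2]
      ring)
  have e1 := hc (Lm b) hL (1, 0, 1, 0)
  have e2 := hc (Lm b) hL (1, 0, 0, 1)
  have e3 := hc (Lm b) hL (1, 0, 1, 1)
  have e4 := hc (Lm b) hL (0, 1, 1, 1)
  have e5 := hc (Lm b) hL (0, 1, 1, 0)
  simp only [act4, Lm_00, Lm_01, Lm_10, Lm_11, map_one, map_zero] at e1 e2 e3 e4 e5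
  set b' := σ b with hb'
  have hb'0 : b' ≠ 0 := by rw [hb']; exact (map_ne_zero σ).mpr hb
  set k := 1 + c0 * b with hk
  set m := k * b' - b with hm
  have f1 : m ^ 2 + c * b ^ 2 * b' ^ 2 = 0 := by rw [hm, hk]; linear_combination e1
  have f2 : k ^ 2 + c * b ^ 2 = 1 := by rw [hk]; linear_combination e2
  have f3 : k * m + c * b ^ 2 * b' = 0 := by
    have : 2 * (k * m + c * b ^ 2 * b') = 0 := by
      rw [hm, hk]
      linear_combination e3 - e2 - e1
    exact (mul_eq_zero.mp this).resolve_left htwo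
  have f4 : m * b = 0 := by
    have : m * (k * b' - m) = 0 := by linear_combination b' * f3 - f1
    rw [hm] at this ⊢
    linear_combination this
  have f5 : m = 0 := (mul_eq_zero.mp f4).resolve_right hb
  have f6 : c = 0 := by
    have : c * (b ^ 2 * b') = 0 := by linear_combination f3 - k * f5
    exact (mul_eq_zero.mp this).resolve_right (mul_ne_zero (pow_ne_zero _ hb) hb'0)
  have f7 : (k - 1) * (k + 1) = 0 := by linear_combination f2 - b ^ 2 * f6
  rcases mul_eq_zero.mp f7 with h | h
  · rw [hm] at f5
    linear_combination f5 - b' * h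
  · exfalso
    have hb2 : b' = - b := by rw [hm] at f5; linear_combination b' * h - f5
    have hcb : c0 * b = -2 := by rw [hk] at h; linear_combination h
    have h4 : 2 * 2 * c0 = 0 := by
      rw [f6, hb2] at e4
      linear_combination e4 - (c0 * b - 2 * c0) * hcb
    have hc00 : c0 = 0 :=
      (mul_eq_zero.mp h4).resolve_left (mul_ne_zero htwo htwo)
    rw [hc00, zero_mul] at hcb
    exact htwo (by linear_combination hcb)
end field

section field
variable {F : Type*} [Field F] [Finite F]

theorem subring_frob (p : ℕ) [CharP F p] (K : Subring F) :
    ∃ m : ℕ, 1 ≤ m ∧ Nat.card K = p ^ m ∧ ∀ v ∈ K, v ^ (p ^ m) = v := by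
  classical
  have := Fintype.ofFinite K
  let _ : Field K := Fintype.fieldOfDomain K
  have : CharP K p := (RingHom.charP_iff (K.subtype) Subtype.val_injective p).2 inferInstance
  obtain ⟨m, -, hm⟩ := FiniteField.card K p
  refine ⟨m, m.2, by rw [Nat.card_eq_fintype_card, hm], fun v hv => ?_⟩
  have := FiniteField.pow_card (⟨v, hv⟩ : K)
  rw [hm] at this
  exact congrArg Subtype.val this

theorem mem_of_pow_eq (K : Subring F) (b : F) (q : ℕ) (hq1 : 1 < q) (hq : Nat.card K = q)
    (hK : ∀ v ∈ K, v ^ q = v) (hb : b ^ q = b) : b ∈ K := by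
  classical
  have := Fintype.ofFinite K
  by_contra hbK
  let pl : Polynomial F := Polynomial.X ^ q - Polynomial.X
  have hpl : pl ≠ 0 := FiniteField.X_pow_card_sub_X_ne_zero F hq1
  have hdeg : pl.natDegree = q := FiniteField.X_pow_card_sub_X_natDegree_eq F hq1
  let S : Finset F := insert b (Finset.univ.image (fun v : K => (v : F)))
  have hS : S ⊆ pl.roots.toFinset := by
    intro x hx
    rw [Multiset.mem_toFinset, Polynomial.mem_roots hpl, Polynomial.IsRoot.def]
    have : x ^ q = x := by
      rcases Finset.mem_insert.mp hx with rfl | hx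
      · exact hb
      · obtain ⟨v, -, rfl⟩ := Finset.mem_image.mp hx
        exact hK _ v.2
    simp [pl, this]
  have h1 := Finset.card_le_card hS
  have h2 := Multiset.toFinset_card_le pl.roots
  have h3 := Polynomial.card_roots' pl
  have h4 : S.card = q + 1 := by
    rw [Finset.card_insert_of_notMem, Finset.card_image_of_injective _ Subtype.val_injective,
      Finset.card_univ, ← Nat.card_eq_fintype_card, hq]
    intro h
    obtain ⟨v, -, rfl⟩ := Finset.mem_image.mp h
    exact hbK v.2
  omega

theorem three_case (b : F) (G : Subgroup SL(2, F)) (h3 : (3 : F) = 0)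
    (hL : Lm b ∈ G) (hE : Em 1 ∈ G)
    (h4 : ∀ n ∈ G, n 1 0 = 0 → (n 0 0) ^ 4 = 1) (hb : b ^ 2 = b + 1) : False := by
  have hm : Lm b * Em 1 * Lm b * Em 1 * Lm (-b) ∈ G := by
    refine G.mul_mem (G.mul_mem (G.mul_mem (G.mul_mem hL hE) hL) hE) ?_
    rw [Lm_neg]; exact G.inv_mem hL
  have := h4 _ hm (by
    simp only [sl_mul, Lm_00, Lm_01, Lm_10, Lm_11, Em_00, Em_01, Em_10, Em_11]
    linear_combination -(b + 3) * hb - (b + 1) * h3)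
  simp only [sl_mul, Lm_00, Lm_01, Lm_10, Lm_11, Em_00, Em_01, Em_10, Em_11] at this
  have e1 : 1 - b - b ^ 2 = b := by linear_combination - hb - b * h3
  have e2 : (1 - b - b ^ 2) ^ 4 = 1 := by linear_combination this
  rw [e1] at e2
  exact one_ne_zero (α := F) (by linear_combination e2 - (b ^ 2 + b + 2) * hb - b * h3)

theorem dickson (p : ℕ) [hp : Fact p.Prime] (hp2 : p ≠ 2) [CharP F p] (G : Subgroup SL(2, F))
    (b : F) (hb : b ≠ 0) (hL : Lm b ∈ G) (hE : Em 1 ∈ G) (hex : ¬ (p = 3 ∧ b ^ 2 = -1)) :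
    ∃ K : Subring F, b ∈ K ∧ ∀ v ∈ K, Em v ∈ G := by
  have h2 : (2 : F) ≠ 0 := by
    have := Ring.two_ne_zero (R := F) (by rw [ringChar.eq F p]; exact hp2)
    exact this
  have hKV := Kof_iff G b hb hL hE
  refine ⟨Kof (Vof G), ?_, fun v hv => (hKV v).1 hv⟩
  obtain ⟨m, hm1, hcard, hfr⟩ := subring_frob p (Kof (Vof G))
  obtain ⟨z, hz⟩ := exists_complement G b hb hL hE h2
  have hcV : Nat.card (Vof G) = p ^ m := by
    rw [← hcard]
    exact Nat.card_congr (Equiv.subtypeEquivRight fun x => (hKV x).symm)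
  have hp3 : 3 ≤ p := by
    have := hp.out.two_le
    omega
  have hpm : p ≤ p ^ m := Nat.le_self_pow (by omega) p
  by_cases h5 : 5 ≤ p ^ m
  · have := form_two G b hb hL h2 (by omega) (iterateFrobenius F p m)
      (fun v hv => by rw [iterateFrobenius_def]; exact hfr v ((hKV v).2 hv))
      (fun n hn h0 => by
        rw [iterateFrobenius_def, ← sq_eq_sq_iff_eq_or_eq_neg, ← pow_mul, mul_comm, pow_mul]
        exact hfr _ (sq_mem_Kof G n hn h0)) z hz
    rw [iterateFrobenius_def] at this
    exact mem_of_pow_eq _ b _ (by omega) hcard hfr this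
  · have hp' : p = 3 := by
      have : p ≠ 4 := by rintro rfl; exact absurd hp.out (by decide)
      omega
    subst hp'
    have hm : m = 1 := by
      by_contra hne
      have : 3 ^ 2 ≤ 3 ^ m := Nat.pow_le_pow_right (by norm_num) (by omega)
      omega
    subst hm
    have h30 : (3 : F) = 0 := by exact_mod_cast CharP.cast_eq_zero F 3
    have h4 : ∀ n ∈ G, n 1 0 = 0 → (n 0 0) ^ 4 = 1 := by
      intro n hn h0
      have h := hfr _ (sq_mem_Kof G n hn h0)
      have hne := upper_ne n h0
      have : (n 0 0) ^ 2 * ((n 0 0) ^ 4 - 1) = 0 := by linear_combination h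
      have := (mul_eq_zero.mp this).resolve_left (pow_ne_zero _ hne)
      linear_combination this
    have h9 := form_one G b hb hL (by omega) (iterateFrobenius F 3 2)
      (fun v hv => by
        rw [iterateFrobenius_def]
        have := hfr v ((hKV v).2 hv)
        calc v ^ 3 ^ 2 = (v ^ 3 ^ 1) ^ 3 ^ 1 := by ring
          _ = v := by rw [this, this])
      (fun n hn h0 => by
        rw [iterateFrobenius_def]
        have := h4 n hn h0
        linear_combination (n 0 0 ^ 5 + n 0 0) * this) z hz
    rw [iterateFrobenius_def] at h9
    have hfac : b * ((b - 1) * ((b + 1) * ((b ^ 2 + 1) * ((b ^ 2 + b - 1) * (b ^ 2 - b - 1))))) =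
        0 := by
      linear_combination h9 - (b ^ 3 * (b ^4 - 1)) * h30
    have h1K : (1 : F) ∈ Kof (Vof G) := (Kof _).one_mem
    rcases mul_eq_zero.mp hfac with h | h
    · exact absurd h hb
    rcases mul_eq_zero.mp h with h | h
    · rwa [sub_eq_zero.mp h]
    rcases mul_eq_zero.mp h with h | h
    · rw [eq_neg_of_add_eq_zero_left h]; exact (Kof _).neg_mem h1K
    rcases mul_eq_zero.mp h with h | h
    · exact absurd ⟨rfl, eq_neg_of_add_eq_zero_left h⟩ hex
    rcases mul_eq_zero.mp h with h | h
    · exact (three_case (-b) G h30 (by rw [Lm_neg]; exact G.inv_mem hL) hE h4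
        (by linear_combination h)).elim
    · exact (three_case b G h30 hL hE h4 (by linear_combination h)).elim

end field

/-- The Weyl element. -/
def Wm {R : Type*} [CommRing R] : SL(2, R) :=
  ⟨!![0, 1; -1, 0], by rw [Matrix.det_fin_two_of]; ring⟩

section weyl
variable {R : Type*} [CommRing R]
@[simp] theorem Wm_00 : (Wm : SL(2, R)) 0 0 = 0 := rfl
@[simp] theorem Wm_01 : (Wm : SL(2, R)) 0 1 = 1 := rfl
@[simp] theorem Wm_10 : (Wm : SL(2, R)) 1 0 = -1 := rfl
@[simp] theorem Wm_11 : (Wm : SL(2, R)) 1 1 = 0 := rfl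

theorem Wm_conj_E (x : R) : Wm * Em x * Wm⁻¹ = Lm (-x) := by
  apply sl_ext <;> simp [sl_mul, sl_inv]

theorem Wm_conj_L (x : R) : Wm * Lm x * Wm⁻¹ = Em (-x) := by
  apply sl_ext <;> simp [sl_mul, sl_inv]

end weyl

section field
variable {F : Type*} [Field F]

theorem gen_of_elem (G : Subgroup SL(2, F)) (hE : ∀ x, Em x ∈ G) (hL : ∀ x, Lm x ∈ G) :
    G = ⊤ := by
  have key : ∀ g : SL(2, F), g 1 0 ≠ 0 → g ∈ G := by
    intro g hg
    have : g = Em ((g 0 0 - 1) / g 1 0) * Lm (g 1 0) * Em ((g 1 1 - 1) / g 1 0) := by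
      have hd := sl_det g
      apply sl_ext <;> simp only [sl_mul, Em_00, Em_01, Em_10, Em_11, Lm_00, Lm_01, Lm_10, Lm_11]
        <;> field_simp
      · ring
      · linear_combination - hd
      · ring
      · ring
    rw [this]
    exact G.mul_mem (G.mul_mem (hE _) (hL _)) (hE _)
  rw [eq_top_iff]
  rintro g -
  by_cases h : g 1 0 = 0
  · have h0 : g 0 0 ≠ 0 := by
      intro h0
      have := sl_det g
      rw [h, h0] at this
      simp at this
    have := key (Lm 1 * g) (by simpa [sl_mul, h] using h0)
    exact (G.mul_mem_cancel_left (hL 1)).1 this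
  · exact key g h

theorem L_of_E (G : Subgroup SL(2, F)) (hE : ∀ x, Em x ∈ G) (b : F) (hb : b ≠ 0) (hL : Lm b ∈ G)
    (x : F) : Lm x ∈ G := by
  have hw : Lm b * Em (-b⁻¹) * Lm b ∈ G := G.mul_mem (G.mul_mem hL (hE _)) hL
  have : Lm x = (Lm b * Em (-b⁻¹) * Lm b) * Em (- x / b ^ 2) * (Lm b * Em (-b⁻¹) * Lm b)⁻¹ := by
    apply sl_ext <;> simp only [sl_mul, sl_inv, Em_00, Em_01, Em_10, Em_11, Lm_00, Lm_01, Lm_10,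
      Lm_11] <;> field_simp <;> ring
  rw [this]
  exact G.mul_mem (G.mul_mem hw (hE _)) (G.inv_mem hw)

theorem sl2_top [Finite F] (p : ℕ) [hp : Fact p.Prime] (hp2 : p ≠ 2) [CharP F p]
    (G : Subgroup SL(2, F)) (a : F) (ha : a ≠ 0) (hgen : ∀ K : Subring F, a ∈ K → K = ⊤)
    (hE : Em a ∈ G) (hL : Lm 1 ∈ G) (hex : ¬ (p = 3 ∧ a ^ 2 = -1)) : G = ⊤ := by
  let G' : Subgroup SL(2, F) := G.comap (MulAut.conj (Wm : SL(2, F))).toMonoidHom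
  have hm : ∀ g, g ∈ G' ↔ Wm * g * Wm⁻¹ ∈ G := fun g => Iff.rfl
  have hE' : Em 1 ∈ G' := by rw [hm, Wm_conj_E, Lm_neg]; exact G.inv_mem hL
  have hL' : Lm a ∈ G' := by rw [hm, Wm_conj_L, Em_neg]; exact G.inv_mem hE
  obtain ⟨K, hK, hKE⟩ := dickson p hp2 G' a ha hL' hE' hex
  rw [hgen K hK] at hKE
  have hall : ∀ x, Em x ∈ G' := fun x => hKE x trivial
  have := gen_of_elem G' hall (L_of_E G' hall a ha hL')
  rw [eq_top_iff]
  rintro g -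
  have h : Wm⁻¹ * g * Wm ∈ G' := by rw [this]; trivial
  rw [hm] at h
  simpa [mul_assoc] using h

end field

/-- Diagonal element. -/
def Dm {F : Type*} [Field F] (t : F) (ht : t ≠ 0) : SL(2, F) :=
  ⟨!![t, 0; 0, t⁻¹], by rw [Matrix.det_fin_two_of]; field_simp; ring⟩

section field
variable {F : Type*} [Field F]

@[simp] theorem Dm_00 (t : F) (ht : t ≠ 0) : Dm t ht 0 0 = t := rfl
@[simp] theorem Dm_01 (t : F) (ht : t ≠ 0) : Dm t ht 0 1 = 0 := rfl
@[simp] theorem Dm_10 (t : F) (ht : t ≠ 0) : Dm t ht 1 0 = 0 := rfl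
@[simp] theorem Dm_11 (t : F) (ht : t ≠ 0) : Dm t ht 1 1 = t⁻¹ := rfl

theorem Dm_conj_E (t : F) (ht : t ≠ 0) (x : F) : Dm t ht * Em x * (Dm t ht)⁻¹ = Em (t ^ 2 * x) := by
  apply sl_ext <;> simp [sl_mul, sl_inv, ht]; ring

theorem Dm_conj_L (t : F) (ht : t ≠ 0) (x : F) : (Dm t ht)⁻¹ * Lm x * (Dm t ht) = Lm (t ^ 2 * x) := by
  apply sl_ext <;> simp [sl_mul, sl_inv, ht]; ring

theorem Em_pow (x : F) (k : ℕ) : Em x ^ k = Em (k * x) := by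
  induction k with
  | zero => simp [Em_zero]
  | succ k ih => rw [pow_succ, ih, ← Em_add]; congr 1; push_cast; ring

theorem Lm_pow (x : F) (k : ℕ) : Lm x ^ k = Lm (k * x) := by
  induction k with
  | zero => simp [Lm_zero]
  | succ k ih => rw [pow_succ, ih, ← Lm_add]; congr 1; push_cast; ring

theorem Em_inj {x y : F} (h : Em x = Em y) : x = y := congrArg (fun g : SL(2, F) => g 0 1) h

theorem Lm_inj {x y : F} (h : Lm x = Lm y) : x = y := congrArg (fun g : SL(2, F) => g 1 0) h

theorem normal_top (h2 : (2 : F) ≠ 0) (N : Subgroup SL(2, F)) [hN : N.Normal] (y : F) (hy : y ≠ 0)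
    (h : Em y ∈ N) : N = ⊤ := by
  have hsq : ∀ t : F, Em (t ^ 2 * y) ∈ N := by
    intro t
    rcases eq_or_ne t 0 with rfl | ht
    · simp [Em_zero, N.one_mem]
    · rw [← Dm_conj_E t ht]
      exact hN.conj_mem _ h _
  have hE : ∀ x, Em x ∈ N := by
    intro x
    have : x = ((x / y + 1) / 2) ^ 2 * y + -(((x / y - 1) / 2) ^ 2 * y) := by
      field_simp; ring
    rw [this, Em_add, Em_neg]
    exact N.mul_mem (hsq _) (N.inv_mem (hsq _))
  refine gen_of_elem N hE fun x => ?_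
  rw [← neg_neg x, ← Wm_conj_E]
  exact hN.conj_mem _ (hE _) _

theorem semisimple_order [Finite F] (p : ℕ) [hp : Fact p.Prime] [CharP F p] (s : SL(2, F))
    (hs : (s 0 0 + s 1 1) ^ 2 ≠ 4) : ∃ M : ℕ, ¬ p ∣ M ∧ s ^ M = 1 := by
  classical
  obtain ⟨k, M, hM, hk⟩ := Nat.exists_eq_pow_mul_and_not_dvd (orderOf_pos s).ne' p hp.out.ne_one
  refine ⟨M, hM, ?_⟩
  set u := s ^ M with hu
  have hup : u ^ (p ^ k) = 1 := by
    rw [hu, ← pow_mul, mul_comm, ← hk, pow_orderOf_eq_one]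
  have hcom : s * u = u * s := by rw [hu, ← pow_succ, ← pow_succ']
  have hnil : (u.1 - 1) ^ (p ^ k) = 0 := by
    rw [sub_pow_char_pow_of_commute _ _ (Commute.one_right _)]
    have := congrArg (fun g : SL(2, F) => g.1) hup
    simp only [Matrix.SpecialLinearGroup.coe_pow] at this
    rw [this]
    simp
  have hdet : (u.1 - 1).det = 0 := by
    have := congrArg Matrix.det hnil
    rw [Matrix.det_pow, Matrix.det_zero] at this
    exact eq_zero_of_pow_eq_zero this
  have hdu := sl_det u
  have htr : u 0 0 + u 1 1 = 2 := by
    rw [Matrix.det_fin_two] at hdet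
    have h : (u 0 0 - 1) * (u 1 1 - 1) - u 0 1 * u 1 0 = 0 := by simpa using hdet
    linear_combination hdu - h
  have hds := sl_det s
  have c00 := congrArg (fun g : SL(2, F) => g 0 0) hcom
  have c01 := congrArg (fun g : SL(2, F) => g 0 1) hcom
  have c10 := congrArg (fun g : SL(2, F) => g 1 0) hcom
  simp only [sl_mul] at c00 c01 c10
  have h11 : u 1 1 = 2 - u 0 0 := by linear_combination htr
  set α := u 0 0 - 1 with hα
  have hα' : u 0 0 = 1 + α := by rw [hα]; ring
  rw [h11, hα'] at c01 c10 hdu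
  have hq : α ^ 2 + u 0 1 * u 1 0 = 0 := by linear_combination - hdu
  have hβ : u 0 1 = 0 := by
    by_contra hne
    apply hs
    have : (u 0 1) ^ 2 * ((s 0 0 + s 1 1) ^ 2 - 4) = 0 := by
      have e1 : u 0 1 * (s 0 0 - s 1 1) = 2 * α * s 0 1 := by linear_combination c01
      have e2 : s 0 1 * u 1 0 = u 0 1 * s 1 0 := by linear_combination c00
      linear_combination (u 0 1 * (s 0 0 - s 1 1) + 2 * α * s 0 1) * e1
        - 4 * s 0 1 * u 0 1 * e2 + 4 * (s 0 1) ^ 2 * hq + 4 * (u 0 1)^2 * hds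
    have := (mul_eq_zero.mp this).resolve_left (pow_ne_zero _ hne)
    linear_combination this
  have hγ : u 1 0 = 0 := by
    by_contra hne
    apply hs
    have : (u 1 0) ^ 2 * ((s 0 0 + s 1 1) ^ 2 - 4) = 0 := by
      have e1 : u 1 0 * (s 0 0 - s 1 1) = 2 * α * s 1 0 := by linear_combination - c10
      have e2 : s 0 1 * u 1 0 = u 0 1 * s 1 0 := by linear_combination c00
      linear_combination (u 1 0 * (s 0 0 - s 1 1) + 2 * α * s 1 0) * e1
        + 4 * s 1 0 * u 1 0 * e2 + 4 * (s 1 0) ^ 2 * hq + 4 * (u 1 0)^2 * hds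
    have := (mul_eq_zero.mp this).resolve_left (pow_ne_zero _ hne)
    linear_combination this
  have hα0 : α = 0 := by
    rw [hβ] at hq
    exact eq_zero_of_pow_eq_zero (n := 2) (by linear_combination hq)
  apply sl_ext
  · rw [hα', hα0]; simp
  · rw [hβ]; simp
  · rw [hγ]; simp
  · rw [h11, hα', hα0, sl_one11]; ring

/-- upper triangular with diagonal entries plus or minus one -/
def Bpm (F : Type*) [Field F] : Subgroup SL(2, F) where
  carrier := {g | g 1 0 = 0 ∧ (g 0 0) ^ 2 = 1}
  one_mem' := by simp
  mul_mem' := by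
    rintro a b ⟨ha, ha'⟩ ⟨hb, hb'⟩
    refine ⟨by rw [sl_mul, ha, hb]; ring, ?_⟩
    rw [sl_mul, hb]
    linear_combination (b 0 0) ^ 2 * ha' + hb'
  inv_mem' := by
    rintro a ⟨ha, ha'⟩
    refine ⟨by rw [(sl_inv a).2.2.1, ha, neg_zero], ?_⟩
    rw [(sl_inv a).1]
    have := sl_det a
    rw [ha] at this
    linear_combination -(a 1 1)^2 * ha' + (a 0 0 * a 1 1 + 1) * this

theorem mem_Bpm (g : SL(2, F)) : g ∈ Bpm F ↔ g 1 0 = 0 ∧ (g 0 0) ^ 2 = 1 := Iff.rfl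

theorem Bpm_sq (g : SL(2, F)) (h : g ∈ Bpm F) : ∃ y, g * g = Em y := by
  obtain ⟨h0, h1⟩ := h
  have hd := sl_det g
  refine ⟨(g * g) 0 1, ?_⟩
  rw [h0] at hd
  apply sl_ext
  · simp only [sl_mul, Em_00, h0]; linear_combination h1
  · simp
  · simp only [sl_mul, Em_10, h0]; ring
  · simp only [sl_mul, Em_11, h0]
    linear_combination -(g 1 1)^2 * h1 + (g 0 0 * g 1 1 + 1) * hd

end field

section pair
variable {F₁ F₂ : Type*} [Field F₁] [Field F₂] [Finite F₁] [Finite F₂]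
variable {D : Type*} [Group D]

theorem ns_trace (p : ℕ) [hp : Fact p.Prime] [CharP F₁ p] [CharP F₂ p]
    (ρ₁ : D →* SL(2, F₁)) (ρ₂ : D →* SL(2, F₂))
    (ns1 : ∀ d x, ρ₁ d = Em x → ρ₂ d = 1 → x = 0) (h : D) (x : F₁) (hx : x ≠ 0)
    (h1 : ρ₁ h = Em x) : (ρ₂ h 0 0 + ρ₂ h 1 1) ^ 2 = 4 := by
  by_contra hne
  obtain ⟨M, hM, hs⟩ := semisimple_order p (ρ₂ h) hne
  have := ns1 (h ^ M) (M * x) (by rw [map_pow, h1, Em_pow]) (by rw [map_pow, hs])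
  rcases mul_eq_zero.mp this with h | h
  · exact hM ((CharP.cast_eq_zero_iff F₁ p M).1 h)
  · exact hx h

theorem ns_three (p : ℕ) [hp : Fact p.Prime] (h2 : (2 : F₂) ≠ 0) [CharP F₁ p] [CharP F₂ p]
    (ρ₁ : D →* SL(2, F₁)) (ρ₂ : D →* SL(2, F₂))
    (ns1 : ∀ d x, ρ₁ d = Em x → ρ₂ d = 1 → x = 0) (h T : D) (x a₁ : F₁) (a₂ : F₂) (ha₂ : a₂ ≠ 0)
    (hT1 : ρ₁ T = Em a₁) (hT2 : ρ₂ T = Em a₂)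
    (h1 : ρ₁ h = Em x) (k : ℕ) (hk0 : x + k * a₁ ≠ 0) (hk1 : x + (k + 1 : ℕ) * a₁ ≠ 0)
    (hk2 : x + (k + 2 : ℕ) * a₁ ≠ 0) : ρ₂ h ∈ Bpm F₂ := by
  have key : ∀ j : ℕ, x + j * a₁ ≠ 0 →
      (ρ₂ h 0 0 + ρ₂ h 1 1 + j * a₂ * ρ₂ h 1 0) ^ 2 = 4 := by
    intro j hj
    have := ns_trace p ρ₁ ρ₂ ns1 (T ^ j * h) _ hj (by
      rw [map_mul, map_pow, hT1, h1, Em_pow, ← Em_add, add_comm])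
    rw [map_mul, map_pow, hT2, Em_pow] at this
    simp only [sl_mul, Em_00, Em_01, Em_10, Em_11] at this
    linear_combination this
  have e0 := key k hk0
  have e1 := key _ hk1
  have e2 := key _ hk2
  push_cast at e1 e2
  have hc : ρ₂ h 1 0 = 0 := by
    set c := a₂ * ρ₂ h 1 0 with hc
    have h8 : 2 * c ^ 2 = 0 := by rw [hc]; linear_combination e2 - 2 * e1 + e0
    have hc0 : c = 0 := eq_zero_of_pow_eq_zero ((mul_eq_zero.mp h8).resolve_left h2)
    exact (mul_eq_zero.mp hc0).resolve_left ha₂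
  refine ⟨hc, ?_⟩
  have hd := sl_det (ρ₂ h)
  rw [hc] at e0 hd
  have hz : (ρ₂ h 0 0 - ρ₂ h 1 1) ^ 2 = 0 := by linear_combination e0 - 4 * hd
  have := eq_zero_of_pow_eq_zero hz
  linear_combination hd + ρ₂ h 0 0 * this

theorem ns_upper (p : ℕ) [hp : Fact p.Prime] (hp2 : p ≠ 2) [CharP F₁ p] [CharP F₂ p]
    (hF : 3 < Nat.card F₁)
    (ρ₁ : D →* SL(2, F₁)) (ρ₂ : D →* SL(2, F₂)) (hs1 : Function.Surjective ρ₁)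
    (ns1 : ∀ d x, ρ₁ d = Em x → ρ₂ d = 1 → x = 0) (T : D) (a₁ : F₁) (a₂ : F₂) (ha₁ : a₁ ≠ 0)
    (ha₂ : a₂ ≠ 0) (hT1 : ρ₁ T = Em a₁) (hT2 : ρ₂ T = Em a₂)
    (h : D) (x : F₁) (h1 : ρ₁ h = Em x) : ρ₂ h ∈ Bpm F₂ := by
  classical
  have h2 : (2 : F₂) ≠ 0 := Ring.two_ne_zero (R := F₂) (by rw [ringChar.eq F₂ p]; exact hp2)
  have gen : ∀ (h : D) (x : F₁), ρ₁ h = Em x → (∀ m : ℕ, x + m * a₁ ≠ 0) → ρ₂ h ∈ Bpm F₂ :=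
    fun h x h1 hx => ns_three p h2 ρ₁ ρ₂ ns1 h T x a₁ a₂ ha₂ hT1 hT2 h1 0 (hx _) (hx _) (hx _)
  by_cases hex : ∃ m : ℕ, x + m * a₁ = 0
  · obtain ⟨m, hm⟩ := hex
    have hp2' := hp.out.two_le
    by_cases hp3 : p = 3
    · subst hp3
      obtain ⟨x0, hx0⟩ : ∃ x0 : F₁, ∀ m : ℕ, x0 + m * a₁ ≠ 0 := by
        by_contra hcon
        push Not at hcon
        have := Fintype.ofFinite F₁
        have hsub : (Finset.univ : Finset F₁) ⊆
            (Finset.range 3).image (fun m : ℕ => -((m : F₁) * a₁)) := by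
          intro y _
          obtain ⟨m, hm⟩ := hcon y
          refine Finset.mem_image.mpr ⟨m % 3, Finset.mem_range.mpr (Nat.mod_lt _ (by norm_num)), ?_⟩
          have : (m : F₁) = ((m % 3 : ℕ) : F₁) := CharP.cast_eq_mod F₁ 3 m
          rw [← this]
          linear_combination - hm
        have h1 := Finset.card_le_card hsub
        have h2 := Finset.card_image_le (s := Finset.range 3) (f := fun m : ℕ => -((m : F₁) * a₁))
        rw [Finset.card_range] at h2
        rw [Finset.card_univ, ← Nat.card_eq_fintype_card] at h1
        omega
      obtain ⟨h0, hh0⟩ := hs1 (Em x0)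
      have b0 := gen h0 x0 hh0 hx0
      have b1 := gen (h0 * h) (x0 + x) (by rw [map_mul, hh0, h1, Em_add]) (by
        intro j hj
        by_cases hjm : m ≤ j
        · apply hx0 (j - m)
          rw [Nat.cast_sub hjm]
          linear_combination hj - hm
        · apply hx0 (j + 3 * m - m)
          rw [Nat.cast_sub (by omega)]
          have : ((3 : ℕ) : F₁) = 0 := CharP.cast_eq_zero F₁ 3
          push_cast at this ⊢
          linear_combination hj - hm + m * a₁ * this)
      rw [map_mul] at b1
      exact ((Bpm F₂).mul_mem_cancel_left b0).1 b1
    · have hp4 : p ≠ 4 := by rintro rfl; exact absurd hp.out (by decide)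
      have hne : ∀ j : ℕ, 1 ≤ j → j < 4 → x + (m + j : ℕ) * a₁ ≠ 0 := by
        intro j hj1 hj4 hj
        have : (j : F₁) * a₁ = 0 := by push_cast at hj; linear_combination hj - hm
        have hj0 := (mul_eq_zero.mp this).resolve_right ha₁
        have := Nat.le_of_dvd (by omega) ((CharP.cast_eq_zero_iff F₁ p j).1 hj0)
        omega
      exact ns_three p h2 ρ₁ ρ₂ ns1 h T x a₁ a₂ ha₂ hT1 hT2 h1 (m + 1) (hne 1 (by norm_num) (by norm_num))
        (hne 2 (by norm_num) (by norm_num)) (hne 3 (by norm_num) (by norm_num))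
  · push Not at hex
    exact gen h x h1 hex

theorem ns_theta (p : ℕ) [hp : Fact p.Prime] (hp2 : p ≠ 2) [CharP F₁ p] [CharP F₂ p]
    (hF : 3 < Nat.card F₁)
    (ρ₁ : D →* SL(2, F₁)) (ρ₂ : D →* SL(2, F₂)) (hs1 : Function.Surjective ρ₁)
    (ns1 : ∀ d x, ρ₁ d = Em x → ρ₂ d = 1 → x = 0) (T : D) (a₁ : F₁) (a₂ : F₂) (ha₁ : a₁ ≠ 0)
    (ha₂ : a₂ ≠ 0) (hT1 : ρ₁ T = Em a₁) (hT2 : ρ₂ T = Em a₂) :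
    ∃ θ : F₁ → F₂, ∀ u, ∃ h, ρ₁ h = Em u ∧ ρ₂ h = Em (θ u) := by
  have h2 : (2 : F₁) ≠ 0 := Ring.two_ne_zero (R := F₁) (by rw [ringChar.eq F₁ p]; exact hp2)
  have : ∀ u : F₁, ∃ y : F₂, ∃ h, ρ₁ h = Em u ∧ ρ₂ h = Em y := by
    intro u
    obtain ⟨h, hh⟩ := hs1 (Em (u / 2))
    obtain ⟨y, hy⟩ := Bpm_sq _ (ns_upper p hp2 hF ρ₁ ρ₂ hs1 ns1 T a₁ a₂ ha₁ ha₂ hT1 hT2 h _ hh)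
    refine ⟨y, h * h, ?_, by rw [map_mul, hy]⟩
    rw [map_mul, hh, ← Em_add]
    congr 1
    field_simp
    ring
  choose θ hθ using this
  exact ⟨θ, hθ⟩

theorem ns_ringHom (p : ℕ) [hp : Fact p.Prime] (hp2 : p ≠ 2) [CharP F₁ p] [CharP F₂ p]
    (hF : 3 < Nat.card F₁)
    (ρ₁ : D →* SL(2, F₁)) (ρ₂ : D →* SL(2, F₂)) (hs1 : Function.Surjective ρ₁)
    (hs2 : Function.Surjective ρ₂)
    (ns1 : ∀ d x, ρ₁ d = Em x → ρ₂ d = 1 → x = 0)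
    (ns2 : ∀ d y, ρ₁ d = 1 → ρ₂ d = Em y → y = 0)
    (T U : D) (a₁ : F₁) (a₂ : F₂) (ha₁ : a₁ ≠ 0)
    (ha₂ : a₂ ≠ 0) (hT1 : ρ₁ T = Em a₁) (hT2 : ρ₂ T = Em a₂)
    (hU1 : ρ₁ U = Lm 1) (hU2 : ρ₂ U = Lm 1) :
    ∃ φ : F₁ →+* F₂, φ a₁ = a₂ := by
  have h2 : (2 : F₂) ≠ 0 := Ring.two_ne_zero (R := F₂) (by rw [ringChar.eq F₂ p]; exact hp2)
  have uniq : ∀ d d' x y y', ρ₁ d = Em x → ρ₁ d' = Em x → ρ₂ d = Em y → ρ₂ d' = Em y' → y = y' := by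
    intro d d' x y y' e1 e2 e3 e4
    have := ns2 (d * d'⁻¹) (y - y') (by rw [map_mul, map_inv, e1, e2, mul_inv_cancel])
      (by rw [map_mul, map_inv, e3, e4, ← Em_neg, ← Em_add, sub_eq_add_neg])
    exact sub_eq_zero.mp this
  -- lower version
  obtain ⟨w1, hw1⟩ := hs1 Wm
  obtain ⟨w2, hw2⟩ := hs2 Wm
  have ns1L : ∀ d x, ρ₁ d = Lm x → ρ₂ d = 1 → x = 0 := by
    intro d x e1 e2
    have := ns1 (w1 * d * w1⁻¹) (-x) (by rw [map_mul, map_mul, map_inv, hw1, e1, Wm_conj_L])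
      (by rw [map_mul, map_mul, map_inv, e2, mul_one, mul_inv_cancel])
    simpa using this
  have ns2L : ∀ d y, ρ₁ d = 1 → ρ₂ d = Lm y → y = 0 := by
    intro d x e1 e2
    have := ns2 (w2 * d * w2⁻¹) (-x) (by rw [map_mul, map_mul, map_inv, e1, mul_one, mul_inv_cancel])
      (by rw [map_mul, map_mul, map_inv, hw2, e2, Wm_conj_L])
    simpa using this
  have uniqL : ∀ d d' x y y', ρ₁ d = Lm x → ρ₁ d' = Lm x → ρ₂ d = Lm y → ρ₂ d' = Lm y' → y = y' := by
    intro d d' x y y' e1 e2 e3 e4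
    have := ns2L (d * d'⁻¹) (y - y') (by rw [map_mul, map_inv, e1, e2, mul_inv_cancel])
      (by rw [map_mul, map_inv, e3, e4, ← Lm_neg, ← Lm_add, sub_eq_add_neg])
    exact sub_eq_zero.mp this
  obtain ⟨θ, hθ⟩ := ns_theta p hp2 hF ρ₁ ρ₂ hs1 ns1 T a₁ a₂ ha₁ ha₂ hT1 hT2
  have hconj : ∀ {F : Type _} [Field F] (g : SL(2, F)) (x : F),
      Wm * g * Wm⁻¹ = Em x → g = Lm (-x) := by
    intro F _ g x hg
    have : Wm * Lm (-x) * Wm⁻¹ = Em x := by rw [Wm_conj_L, neg_neg]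
    rw [← this] at hg
    exact mul_left_cancel (mul_right_cancel hg)
  have hconj2 : ∀ {F : Type _} [Field F] (g : SL(2, F)) (x : F),
      Wm * g * Wm⁻¹ = Em x → g = Lm (-x) := by
    intro F _ g x hg
    have : Wm * Lm (-x) * Wm⁻¹ = Em x := by rw [Wm_conj_L, neg_neg]
    rw [← this] at hg
    exact mul_left_cancel (mul_right_cancel hg)
  obtain ⟨θ0, hθ0⟩ := ns_theta p hp2 hF ((MulAut.conj Wm).toMonoidHom.comp ρ₁)
    ((MulAut.conj Wm).toMonoidHom.comp ρ₂)
    (by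
      intro g
      obtain ⟨d, hd⟩ := hs1 (Wm⁻¹ * g * Wm)
      refine ⟨d, ?_⟩
      change Wm * ρ₁ d * Wm⁻¹ = g
      rw [hd]; group)
    (by
      intro d x e1 e2
      have e1' := hconj (ρ₁ d) x e1
      have e2' : Wm * ρ₂ d * Wm⁻¹ = 1 := e2
      have e3 : ρ₂ d = 1 := by
        rw [mul_inv_eq_one] at e2'
        exact mul_eq_left.mp e2'
      have := ns1L d _ e1' e3
      simpa using this)
    U⁻¹ 1 1 one_ne_zero one_ne_zero
    (by
      change Wm * ρ₁ U⁻¹ * Wm⁻¹ = _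
      rw [map_inv, hU1, ← Lm_neg, Wm_conj_L, neg_neg])
    (by
      change Wm * ρ₂ U⁻¹ * Wm⁻¹ = _
      rw [map_inv, hU2, ← Lm_neg, Wm_conj_L, neg_neg])
  obtain ⟨η, hη⟩ : ∃ η : F₁ → F₂, ∀ u, ∃ h, ρ₁ h = Lm u ∧ ρ₂ h = Lm (η u) := by
    refine ⟨fun u => - θ0 (-u), fun u => ?_⟩
    obtain ⟨h, e1, e2⟩ := hθ0 (-u)
    refine ⟨h, ?_, ?_⟩
    · have := hconj (ρ₁ h) _ e1
      rwa [neg_neg] at this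
    · exact hconj2 (ρ₂ h) _ e2
  have η1 : η 1 = 1 := by
    obtain ⟨h, e1, e2⟩ := hη 1
    exact uniqL h U 1 _ _ e1 hU1 e2 hU2
  have θa : θ a₁ = a₂ := by
    obtain ⟨h, e1, e2⟩ := hθ a₁
    exact uniq h T a₁ _ _ e1 hT1 e2 hT2
  have θadd : ∀ u v, θ (u + v) = θ u + θ v := by
    intro u v
    obtain ⟨h, e1, e2⟩ := hθ u
    obtain ⟨h', e1', e2'⟩ := hθ v
    obtain ⟨h'', e1'', e2''⟩ := hθ (u + v)
    exact uniq h'' (h * h') (u + v) _ _ e1'' (by rw [map_mul, e1, e1', Em_add]) e2''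
      (by rw [map_mul, e2, e2', Em_add])
  have θ0' : θ 0 = 0 := by
    have := θadd 0 0
    rw [add_zero] at this
    simpa using this
  have θneg : ∀ u, θ (-u) = - θ u := by
    intro u
    have := θadd (-u) u
    rw [neg_add_cancel, θ0'] at this
    linear_combination - this
  have hkey : ∀ u, u ≠ 0 → θ u ≠ 0 ∧ ∀ x, θ (u ^ 2 * x) = θ u ^ 2 * η x := by
    intro u hu
    obtain ⟨h, e1, e2⟩ := hθ u
    obtain ⟨l, f1, f2⟩ := hη (-u⁻¹)
    set y := θ u
    set y' := η (-u⁻¹)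
    have hw : ∀ x d, ρ₁ d = Lm x → ρ₁ ((h * l * h) * d * (h * l * h)⁻¹) = Em (- (u ^ 2 * x)) := by
      intro x d hd
      simp only [map_mul, map_inv, e1, f1, hd]
      apply sl_ext <;> simp only [sl_mul, sl_inv, Em_00, Em_01, Em_10, Em_11, Lm_00, Lm_01, Lm_10,
        Lm_11] <;> field_simp <;> ring
    have hP : 1 + y * y' = 0 := by
      have := ns_upper p hp2 hF ρ₁ ρ₂ hs1 ns1 T a₁ a₂ ha₁ ha₂ hT1 hT2 _ _ (hw 1 U hU1)
      have := this.1
      simp only [map_mul, map_inv, e2, f2, hU2, sl_mul, sl_inv, Em_00, Em_01, Em_10, Em_11, Lm_00,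
        Lm_01, Lm_10, Lm_11] at this
      refine eq_zero_of_pow_eq_zero (n := 2) ?_
      linear_combination this
    refine ⟨fun hy => by rw [hy] at hP; simp at hP, fun x => ?_⟩
    obtain ⟨d, g1, g2⟩ := hη x
    obtain ⟨k, k1, k2⟩ := hθ (-(u ^ 2 * x))
    have := uniq _ _ _ _ (- (y ^ 2 * η x)) k1 (hw x d g1) k2 (by
      have w00 : (Em y * Lm y' * Em y) 0 0 = 0 := by
        simp only [sl_mul, Em_00, Em_01, Em_10, Em_11, Lm_00, Lm_01, Lm_10, Lm_11]
        linear_combination hP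
      have w01 : (Em y * Lm y' * Em y) 0 1 = y := by
        simp only [sl_mul, Em_00, Em_01, Em_10, Em_11, Lm_00, Lm_01, Lm_10, Lm_11]
        linear_combination y * hP
      have w10 : (Em y * Lm y' * Em y) 1 0 = y' := by
        simp only [sl_mul, Em_00, Em_01, Em_10, Em_11, Lm_00, Lm_01, Lm_10, Lm_11]
        ring
      have w11 : (Em y * Lm y' * Em y) 1 1 = 0 := by
        simp only [sl_mul, Em_00, Em_01, Em_10, Em_11, Lm_00, Lm_01, Lm_10, Lm_11]
        linear_combination hP
      rw [map_mul, map_mul, map_inv, map_mul, map_mul, e2, f2, g2]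
      generalize Em y * Lm y' * Em y = W at w00 w01 w10 w11
      apply sl_ext <;> simp only [sl_mul, sl_inv, Em_00, Em_01, Em_10, Em_11, Lm_00, Lm_01, Lm_10,
        Lm_11, w00, w01, w10, w11]
      · linear_combination - hP
      · ring
      · ring
      · linear_combination - hP)
    rw [θneg] at this
    linear_combination - this
  obtain ⟨h10, h1x⟩ := hkey 1 one_ne_zero
  have θ1 : θ 1 = 1 := by
    have := h1x 1
    rw [η1, one_pow, one_mul] at this
    have h : θ 1 * (θ 1 - 1) = 0 := by linear_combination - this
    exact sub_eq_zero.mp ((mul_eq_zero.mp h).resolve_left h10)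
  have θη : ∀ x, η x = θ x := by
    intro x
    have := h1x x
    rw [θ1, one_pow, one_mul] at this
    linear_combination - this
  have θsq : ∀ u, θ (u ^ 2) = θ u ^ 2 := by
    intro u
    rcases eq_or_ne u 0 with rfl | hu
    · simp [θ0']
    · have := (hkey u hu).2 1
      rwa [η1, mul_one, mul_one] at this
  refine ⟨RingHom.mk' ⟨⟨θ, θ1⟩, ?_⟩ θadd, θa⟩
  intro u v
  change θ (u * v) = θ u * θ v
  have e := θsq (u + v)
  have : (u + v) ^ 2 = u ^ 2 + v ^ 2 + (u * v + u * v) := by ring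
  rw [this, θadd, θadd, θadd, θadd, θsq, θsq] at e
  have : 2 * (θ (u * v) - θ u * θ v) = 0 := by linear_combination e
  exact sub_eq_zero.mp ((mul_eq_zero.mp this).resolve_left h2)

theorem pair_lemma (p : ℕ) [hp : Fact p.Prime] (hp2 : p ≠ 2) [CharP F₁ p] [CharP F₂ p]
    (hF : 3 < Nat.card F₁)
    (ρ₁ : D →* SL(2, F₁)) (ρ₂ : D →* SL(2, F₂)) (hs1 : Function.Surjective ρ₁)
    (hs2 : Function.Surjective ρ₂)
    (T U : D) (a₁ : F₁) (a₂ : F₂) (ha₁ : a₁ ≠ 0)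
    (ha₂ : a₂ ≠ 0) (hT1 : ρ₁ T = Em a₁) (hT2 : ρ₂ T = Em a₂)
    (hU1 : ρ₁ U = Lm 1) (hU2 : ρ₂ U = Lm 1)
    (hno : ∀ φ : F₁ →+* F₂, φ a₁ ≠ a₂) (m : SL(2, F₂)) : ∃ d, ρ₁ d = 1 ∧ ρ₂ d = m := by
  have h2 : (2 : F₂) ≠ 0 := Ring.two_ne_zero (R := F₂) (by rw [ringChar.eq F₂ p]; exact hp2)
  have h2' : (2 : F₁) ≠ 0 := Ring.two_ne_zero (R := F₁) (by rw [ringChar.eq F₁ p]; exact hp2)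
  by_cases ns2 : ∀ d y, ρ₁ d = 1 → ρ₂ d = Em y → y = 0
  · by_cases ns1 : ∀ d x, ρ₁ d = Em x → ρ₂ d = 1 → x = 0
    · obtain ⟨φ, hφ⟩ := ns_ringHom p hp2 hF ρ₁ ρ₂ hs1 hs2 ns1 ns2 T U a₁ a₂ ha₁ ha₂ hT1 hT2 hU1 hU2
      exact absurd hφ (hno φ)
    · push Not at ns1
      obtain ⟨d, x, e1, e2, hx⟩ := ns1
      have : (ρ₂.ker.map ρ₁).Normal := Subgroup.Normal.map inferInstance ρ₁ hs1
      have htop := normal_top h2' (ρ₂.ker.map ρ₁) x hx ⟨d, e2, e1⟩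
      obtain ⟨g, hg⟩ := hs2 m
      have : ρ₁ g ∈ ρ₂.ker.map ρ₁ := by rw [htop]; trivial
      obtain ⟨g', hg', hg''⟩ := this
      refine ⟨g * g'⁻¹, by rw [map_mul, map_inv, hg'', mul_inv_cancel], ?_⟩
      have : ρ₂ g' = 1 := hg'
      rw [map_mul, map_inv, this, inv_one, mul_one, hg]
  · push Not at ns2
    obtain ⟨d, y, e1, e2, hy⟩ := ns2
    have : (ρ₁.ker.map ρ₂).Normal := Subgroup.Normal.map inferInstance ρ₂ hs2
    have htop := normal_top h2 (ρ₁.ker.map ρ₂) y hy ⟨d, e1, e2⟩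
    have : m ∈ ρ₁.ker.map ρ₂ := by rw [htop]; trivial
    obtain ⟨g, hg, hg'⟩ := this
    exact ⟨g, hg, hg'⟩

end pair

section many
variable {D ι : Type*} [Group D] {F : ι → Type*} [∀ i, Field (F i)] [∀ i, Finite (F i)]

theorem exists_t {K : Type*} [Field K] [Finite K] (h : 3 < Nat.card K) :
    ∃ t : K, t ≠ 0 ∧ t ^ 2 - 1 ≠ 0 := by
  classical
  have := Fintype.ofFinite K
  by_contra hcon
  push Not at hcon
  have hsub : (Finset.univ : Finset K) ⊆ {0, 1, -1} := by
    intro t _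
    by_cases ht : t = 0
    · simp [ht]
    · have := hcon t ht
      have : (t - 1) * (t + 1) = 0 := by linear_combination this
      rcases mul_eq_zero.mp this with h | h
      · simp [sub_eq_zero.mp h]
      · simp [eq_neg_of_add_eq_zero_left h]
  have h1 := Finset.card_le_card hsub
  rw [Finset.card_univ, ← Nat.card_eq_fintype_card] at h1
  have h2 := Finset.card_le_three (a := (0 : K)) (b := 1) (c := -1)
  omega

theorem comm_top {K : Type*} [Field K] [Finite K] (h : 3 < Nat.card K) (N : Subgroup SL(2, K))
    (hN : ∀ a b : SL(2, K), a * b * a⁻¹ * b⁻¹ ∈ N) : N = ⊤ := by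
  obtain ⟨t, ht0, ht⟩ := exists_t h
  apply gen_of_elem
  · intro x
    have := hN (Dm t ht0) (Em (x / (t ^ 2 - 1)))
    rw [Dm_conj_E, ← Em_neg, ← Em_add] at this
    convert! this using 2
    field_simp
    ring
  · intro x
    have := hN (Dm t ht0)⁻¹ (Lm (x / (t ^ 2 - 1)))
    rw [inv_inv, Dm_conj_L, ← Lm_neg, ← Lm_add] at this
    convert! this using 2
    field_simp
    ring

theorem factor_lemma (ρ : ∀ i, D →* SL(2, F i)) (hs : ∀ i, Function.Surjective (ρ i))
    (hbig : ∀ i j, i ≠ j → 3 < Nat.card (F i))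
    (hpair : ∀ i j, i ≠ j → ∀ m, ∃ d, ρ j d = 1 ∧ ρ i d = m) (i : ι) (S : Finset ι) :
    i ∉ S → ∀ m, ∃ d, ρ i d = m ∧ ∀ s ∈ S, ρ s d = 1 := by
  classical
  induction S using Finset.induction_on with
  | empty =>
    intro _ m
    obtain ⟨d, hd⟩ := hs i m
    exact ⟨d, hd, by simp⟩
  | insert j S hj ih =>
    intro hi m
    rw [Finset.mem_insert, not_or] at hi
    have ih := ih hi.2
    have htop := comm_top (hbig i j hi.1) ((⨅ s ∈ insert j S, (ρ s).ker).map (ρ i)) (by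
      intro a b
      obtain ⟨g, hg1, hg2⟩ := hpair i j hi.1 a
      obtain ⟨h, hh1, hh2⟩ := ih b
      refine ⟨g * h * g⁻¹ * h⁻¹, ?_, by simp only [map_mul, map_inv, hg2, hh1]⟩
      simp only [SetLike.mem_coe, Subgroup.mem_iInf, MonoidHom.mem_ker]
      intro s hs
      rcases Finset.mem_insert.mp hs with rfl | hs
      · simp only [map_mul, map_inv, hg1]; group
      · simp only [map_mul, map_inv, hh2 s hs]; group)
    have : m ∈ (⨅ s ∈ insert j S, (ρ s).ker).map (ρ i) := by rw [htop]; trivial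
    obtain ⟨d, hd, hd'⟩ := this
    refine ⟨d, hd', ?_⟩
    simpa only [SetLike.mem_coe, Subgroup.mem_iInf, MonoidHom.mem_ker] using hd

theorem product_lemma [Finite ι] (ρ : ∀ i, D →* SL(2, F i)) (hs : ∀ i, Function.Surjective (ρ i))
    (hbig : ∀ i j, i ≠ j → 3 < Nat.card (F i))
    (hpair : ∀ i j, i ≠ j → ∀ m, ∃ d, ρ j d = 1 ∧ ρ i d = m) (m : ∀ i, SL(2, F i)) :
    ∃ d, ∀ i, ρ i d = m i := by
  classical
  have := Fintype.ofFinite ι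
  have key : ∀ S : Finset ι, ∃ d, ∀ i ∈ S, ρ i d = m i := by
    intro S
    induction S using Finset.induction_on with
    | empty => exact ⟨1, by simp⟩
    | insert j S hj ih =>
      obtain ⟨d, hd⟩ := ih
      obtain ⟨e, he1, he2⟩ := factor_lemma ρ hs hbig hpair j S hj (m j * (ρ j d)⁻¹)
      refine ⟨e * d, fun i hi => ?_⟩
      rcases Finset.mem_insert.mp hi with rfl | hi
      · rw [map_mul, he1, inv_mul_cancel_right]
      · rw [map_mul, he2 i hi, one_mul, hd i hi]
  obtain ⟨d, hd⟩ := key Finset.univ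
  exact ⟨d, fun i => hd i (Finset.mem_univ i)⟩

end many

theorem O_top (ζ : ℂ) (S : Subring (Oring ζ)) (h : lamO ζ ∈ S) : S = ⊤ := by
  rw [eq_top_iff]
  rintro ⟨x, hx⟩ -
  induction hx using Algebra.adjoin_induction with
  | mem x hx =>
    rw [Set.mem_singleton_iff] at hx
    subst hx
    exact h
  | algebraMap r =>
    have : (r : Oring ζ) ∈ S := intCast_mem S r
    convert! this using 1
  | add x y hx hy h1 h2 => exact S.add_mem h1 h2
  | mul x y hx hy h1 h2 => exact S.mul_mem h1 h2

theorem O_hom_ext (ζ : ℂ) {R : Type*} [CommRing R] (f g : Oring ζ →+* R)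
    (h : f (lamO ζ) = g (lamO ζ)) : f = g := by
  have := O_top ζ (RingHom.eqLocus f g) h
  ext x
  have hx : x ∈ RingHom.eqLocus f g := by rw [this]; trivial
  exact hx

theorem cyc_factor (n : ℕ) (hn : 3 ≤ n) (ζ : ℂ) (hζ : IsPrimitiveRoot ζ n) :
    ∃ Q : Polynomial (Oring ζ), Polynomial.cyclotomic n (Oring ζ) =
      (Polynomial.X ^ 2 - Polynomial.C (lamO ζ) * Polynomial.X + 1) * Q := by
  set P : Polynomial (Oring ζ) := Polynomial.X ^ 2 - Polynomial.C (lamO ζ) * Polynomial.X + 1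
    with hP
  have hdeg : P.natDegree = 2 := by rw [hP]; compute_degree!
  have hmon : P.Monic := by rw [hP]; monicity!
  set Φ := Polynomial.cyclotomic n (Oring ζ) with hΦ
  have hdiv := Polynomial.modByMonic_add_div Φ P
  have hrdeg : (Φ %ₘ P).natDegree ≤ 1 := by
    have := Polynomial.natDegree_modByMonic_lt Φ hmon (by
      intro h; rw [h] at hdeg; simp at hdeg)
    omega
  obtain ⟨α, β, hr⟩ := Polynomial.exists_eq_X_add_C_of_natDegree_le_one hrdeg
  have hζ0 : ζ ≠ 0 := hζ.ne_zero (by omega)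
  have hev : ∀ z : ℂ, IsPrimitiveRoot z n → z ^ 2 - (ζ + ζ⁻¹) * z + 1 = 0 →
      (α : ℂ) * z + (β : ℂ) = 0 := by
    intro z hz hz2
    have h1 : Polynomial.eval₂ (algebraMap (Oring ζ) ℂ) z Φ = 0 := by
      rw [← Polynomial.eval_map, hΦ, Polynomial.map_cyclotomic]
      exact hz.isRoot_cyclotomic (by omega)
    rw [← hdiv, hr, Polynomial.eval₂_add, Polynomial.eval₂_mul, hP] at h1
    simp only [Polynomial.eval₂_add, Polynomial.eval₂_sub, Polynomial.eval₂_mul,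
      Polynomial.eval₂_pow, Polynomial.eval₂_C, Polynomial.eval₂_X, Polynomial.eval₂_one] at h1
    have h2 : z ^ 2 - ((algebraMap (Oring ζ) ℂ) (lamO ζ)) * z + 1 = 0 := hz2
    rw [h2, zero_mul, add_zero] at h1
    exact h1
  have e1 := hev ζ hζ (by field_simp; ring)
  have e2 := hev ζ⁻¹ hζ.inv (by field_simp; ring)
  have hα : (α : ℂ) = 0 := by
    have h3 : (α : ℂ) * (ζ ^ 2 - 1) = 0 := by
      have : (α : ℂ) * (ζ - ζ⁻¹) = 0 := by linear_combination e1 - e2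
      field_simp at this
      linear_combination this
    refine (mul_eq_zero.mp h3).resolve_right fun h => ?_
    have := Nat.le_of_dvd (by norm_num) ((hζ.pow_eq_one_iff_dvd 2).1 (sub_eq_zero.mp h))
    omega
  have hβ : (β : ℂ) = 0 := by rw [hα] at e1; linear_combination e1
  have hα' : α = 0 := Subtype.ext hα
  have hβ' : β = 0 := Subtype.ext hβ
  refine ⟨Φ /ₘ P, ?_⟩
  rw [hr, hα', hβ'] at hdiv
  rw [Polynomial.C_0, zero_mul, zero_add, zero_add] at hdiv
  exact hdiv.symm

theorem cyc_root (n : ℕ) (hn : 3 ≤ n) (ζ : ℂ) (hζ : IsPrimitiveRoot ζ n) (p : ℕ)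
    [hp : Fact p.Prime] (e n' : ℕ) (hne : n = p ^ e * n') (hn' : ¬ p ∣ n')
    {k : Type*} [Field k] [CharP k p] (f : Oring ζ →+* k) :
    ∃ z : AlgebraicClosure k, z ^ 2 - algebraMap k (AlgebraicClosure k) (f (lamO ζ)) * z + 1 = 0 ∧
      IsPrimitiveRoot z n' := by
  set c := algebraMap k (AlgebraicClosure k) (f (lamO ζ)) with hc
  have : CharP (AlgebraicClosure k) p :=
    charP_of_injective_algebraMap (algebraMap k (AlgebraicClosure k)).injective p
  obtain ⟨z, hz⟩ := IsAlgClosed.exists_root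
    (Polynomial.X ^ 2 - Polynomial.C c * Polynomial.X + 1 : Polynomial (AlgebraicClosure k)) (by
      have : (Polynomial.X ^ 2 - Polynomial.C c * Polynomial.X + 1 :
        Polynomial (AlgebraicClosure k)).degree = 2 := by compute_degree!
      rw [this]; norm_num)
  have hz' : z ^ 2 - c * z + 1 = 0 := by simpa [Polynomial.IsRoot.def] using hz
  refine ⟨z, hz', ?_⟩
  obtain ⟨Q, hQ⟩ := cyc_factor n hn ζ hζ
  have h1 := congrArg (Polynomial.eval₂ ((algebraMap k (AlgebraicClosure k)).comp f) z) hQ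
  rw [← Polynomial.eval_map, Polynomial.map_cyclotomic, Polynomial.eval₂_mul] at h1
  simp only [Polynomial.eval₂_add, Polynomial.eval₂_sub, Polynomial.eval₂_mul,
      Polynomial.eval₂_pow, Polynomial.eval₂_C, Polynomial.eval₂_X, Polynomial.eval₂_one,
      RingHom.comp_apply, ← hc] at h1
  rw [hz', zero_mul, hne] at h1
  have : NeZero ((n' : ℕ) : AlgebraicClosure k) :=
    ⟨fun h => hn' ((CharP.cast_eq_zero_iff _ p n').1 h)⟩
  exact Polynomial.isRoot_cyclotomic_prime_pow_mul_iff_of_charP.1 h1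

theorem a_ne_zero (n : ℕ) (hn : 3 ≤ n) (ζ : ℂ) (hζ : IsPrimitiveRoot ζ n) (p : ℕ)
    [hp : Fact p.Prime] (hp2 : p ≠ 2) {k : Type*} [Field k] [CharP k p] (f : Oring ζ →+* k)
    (h1 : ∀ k : ℕ, 1 ≤ k → n ≠ 2 * p ^ k) : 2 + f (lamO ζ) ≠ 0 := by
  intro h0
  obtain ⟨e, n', hn', hne⟩ := Nat.exists_eq_pow_mul_and_not_dvd (n := n) (by omega) p hp.out.ne_one
  obtain ⟨z, hz, hprim⟩ := cyc_root n hn ζ hζ p e n' hne hn' f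
  have hl : f (lamO ζ) = -2 := by linear_combination h0
  rw [hl] at hz
  simp only [map_neg, map_ofNat] at hz
  have : CharP (AlgebraicClosure k) p :=
    charP_of_injective_algebraMap (algebraMap k (AlgebraicClosure k)).injective p
  have h2 : (2 : AlgebraicClosure k) ≠ 0 :=
    Ring.two_ne_zero (by rw [ringChar.eq (AlgebraicClosure k) p]; exact hp2)
  have hz1 : z = -1 := by
    have : (z + 1) ^ 2 = 0 := by linear_combination hz
    exact eq_neg_of_add_eq_zero_left (eq_zero_of_pow_eq_zero this)
  have hd : n' ∣ 2 := (hprim.pow_eq_one_iff_dvd 2).1 (by rw [hz1]; norm_num)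
  rcases (Nat.dvd_prime Nat.prime_two).1 hd with h | h
  · rw [h] at hprim
    have := hprim.pow_eq_one
    rw [hz1] at this
    exact h2 (by linear_combination - this)
  · rw [h] at hne
    rcases Nat.eq_zero_or_pos e with he | he
    · rw [he, pow_zero] at hne; omega
    · exact h1 e he (by rw [hne]; ring)

theorem a_sq_ne (n : ℕ) (hn : 3 ≤ n) (ζ : ℂ) (hζ : IsPrimitiveRoot ζ n) (p : ℕ)
    [hp : Fact p.Prime] {k : Type*} [Field k] [CharP k p] (f : Oring ζ →+* k)
    (h2 : ¬(p = 3 ∧ ∃ k : ℕ, n = 5 * 3 ^ k)) :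
    ¬ (p = 3 ∧ (2 + f (lamO ζ)) ^ 2 = -1) := by
  rintro ⟨rfl, h0⟩
  obtain ⟨e, n', hn', hne⟩ := Nat.exists_eq_pow_mul_and_not_dvd (n := n) (by omega) 3 hp.out.ne_one
  obtain ⟨z, hz, hprim⟩ := cyc_root n hn ζ hζ 3 e n' hne hn' f
  have : CharP (AlgebraicClosure k) 3 :=
    charP_of_injective_algebraMap (algebraMap k (AlgebraicClosure k)).injective 3
  have h3 : (3 : AlgebraicClosure k) = 0 := by
    exact_mod_cast CharP.cast_eq_zero (AlgebraicClosure k) 3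
  have h0' := congrArg (algebraMap k (AlgebraicClosure k)) h0
  simp only [map_pow, map_add, map_ofNat, map_neg, map_one] at h0'
  set l := algebraMap k (AlgebraicClosure k) (f (lamO ζ))
  have hl : l ^ 2 + l - 1 = 0 := by linear_combination h0' - (l + 2) * h3
  have h4 : z ^ 4 + z ^ 3 + z ^ 2 + z + 1 = 0 := by
    linear_combination z ^ 2 * hl + (z ^ 2 + l * z + 1 + z) * hz
  have hd : n' ∣ 5 := (hprim.pow_eq_one_iff_dvd 5).1 (by linear_combination (z - 1) * h4)
  rcases (Nat.dvd_prime (by norm_num)).1 hd with h | h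
  · rw [h] at hprim
    have := hprim.pow_eq_one
    rw [pow_one] at this
    rw [this] at h4
    exact one_ne_zero (α := AlgebraicClosure k) (by linear_combination 2 * h3 - h4)
  · exact h2 ⟨rfl, e, by rw [hne, h]; ring⟩

theorem card_gt (n : ℕ) (hn : 3 ≤ n) (ζ : ℂ) (hζ : IsPrimitiveRoot ζ n) (p : ℕ)
    [hp : Fact p.Prime] (hp2 : p ≠ 2) {k : Type*} [Field k] [CharP k p] (f : Oring ζ →+* k)
    {k' : Type*} [Field k'] [CharP k' p] (g : Oring ζ →+* k') [Finite k]
    (h1 : ∀ k : ℕ, 1 ≤ k → n ≠ 2 * p ^ k)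
    (hno : ∀ φ : k →+* k', φ (2 + f (lamO ζ)) ≠ 2 + g (lamO ζ)) : 3 < Nat.card k := by
  by_contra hcard
  have := Fintype.ofFinite k
  rw [Nat.card_eq_fintype_card] at hcard
  obtain ⟨r, -, hr⟩ := FiniteField.card k p
  have hp3 : 3 ≤ p := by have := hp.out.two_le; omega
  have hpr : p ≤ p ^ (r : ℕ) := Nat.le_self_pow r.2.ne' p
  have hp' : p = 3 := by omega
  subst hp'
  have hc3 : Fintype.card k = 3 := by omega
  let φ : k →+* k' := (ZMod.castHom (dvd_refl 3) k').comp
    (ZMod.ringEquivOfPrime k hp.out hc3).symm.toRingHom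
  have a0 := a_ne_zero n hn ζ hζ 3 hp2 f h1
  obtain ⟨e, n', hn', hne⟩ := Nat.exists_eq_pow_mul_and_not_dvd (n := n) (by omega) 3 hp.out.ne_one
  obtain ⟨z, hz, hprim⟩ := cyc_root n hn ζ hζ 3 e n' hne hn' f
  obtain ⟨z', hz', hprim'⟩ := cyc_root n hn ζ hζ 3 e n' hne hn' g
  have : CharP (AlgebraicClosure k) 3 :=
    charP_of_injective_algebraMap (algebraMap k (AlgebraicClosure k)).injective 3
  have : CharP (AlgebraicClosure k') 3 :=
    charP_of_injective_algebraMap (algebraMap k' (AlgebraicClosure k')).injective 3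
  have h3 : (3 : AlgebraicClosure k) = 0 := by
    exact_mod_cast CharP.cast_eq_zero (AlgebraicClosure k) 3
  have h3k : (3 : k) = 0 := by exact_mod_cast CharP.cast_eq_zero k 3
  have h3' : (3 : AlgebraicClosure k') = 0 := by
    exact_mod_cast CharP.cast_eq_zero (AlgebraicClosure k') 3
  have hinj := (algebraMap k' (AlgebraicClosure k')).injective
  have hcube := FiniteField.pow_card (f (lamO ζ))
  rw [hc3] at hcube
  have hfac : f (lamO ζ) * ((f (lamO ζ) + 1) * (f (lamO ζ) + 2)) = 0 := by
    linear_combination hcube + (f (lamO ζ) ^ 2 + f (lamO ζ)) * h3k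
  rcases mul_eq_zero.mp hfac with h | h
  · rw [h] at hz
    rw [map_zero] at hz
    have hz2 : z ^ 2 = -1 := by linear_combination hz
    have hd : n' ∣ 4 := (hprim.pow_eq_one_iff_dvd 4).1 (by linear_combination (z ^ 2 - 1) * hz2)
    have hnd : ¬ n' ∣ 2 := by
      intro hd2
      have := (hprim.pow_eq_one_iff_dvd 2).2 hd2
      exact one_ne_zero (α := AlgebraicClosure k) (by linear_combination h3 + this - hz2)
    have q4 : z' ^ 4 = 1 := (hprim'.pow_eq_one_iff_dvd 4).2 hd
    have q2 : z' ^ 2 - 1 ≠ 0 := fun h =>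
      hnd ((hprim'.pow_eq_one_iff_dvd 2).1 (by linear_combination h))
    have q : (z' ^ 2 - 1) * (z' ^ 2 + 1) = 0 := by linear_combination q4
    have q' := (mul_eq_zero.mp q).resolve_left q2
    have hz0 : z' ≠ 0 := by rintro rfl; simp at q'
    have : algebraMap k' (AlgebraicClosure k') (g (lamO ζ)) * z' = 0 := by
      linear_combination q' - hz'
    have := (mul_eq_zero.mp this).resolve_right hz0
    have hg : g (lamO ζ) = 0 := hinj (by rw [this, map_zero])
    exact hno φ (by rw [h, hg, add_zero, add_zero, map_ofNat])
  rcases mul_eq_zero.mp h with h | h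
  · have hl : f (lamO ζ) = -1 := eq_neg_of_add_eq_zero_left h
    rw [hl, map_neg, map_one] at hz
    have hz1 : z = 1 := by
      have : (z - 1) ^ 2 = 0 := by linear_combination hz - z * h3
      exact sub_eq_zero.mp (eq_zero_of_pow_eq_zero this)
    have hd : n' ∣ 1 := (hprim.pow_eq_one_iff_dvd 1).1 (by rw [hz1]; norm_num)
    have hz1' := (hprim'.pow_eq_one_iff_dvd 1).2 hd
    rw [pow_one] at hz1'
    rw [hz1'] at hz'
    have hg : g (lamO ζ) = -1 := hinj (by
      rw [map_neg, map_one]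
      linear_combination h3' - hz')
    exact hno φ (by rw [hl, hg]; simp only [map_add, map_ofNat, map_neg, map_one])
  · exact a0 (by linear_combination h)

theorem map_entry {R S : Type*} [CommRing R] [CommRing S] (f : R →+* S) (g : SL(2, R)) (i j : Fin 2) :
    (Matrix.SpecialLinearGroup.map f g) i j = f (g i j) := rfl

theorem family_surj (n : ℕ) (hn : 3 ≤ n) (ζ : ℂ) (hζ : IsPrimitiveRoot ζ n)
    (p : ℕ) [hp : Fact p.Prime] (hp2 : p ≠ 2)
    (h1 : ∀ k : ℕ, 1 ≤ k → n ≠ 2 * p ^ k)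
    (h2 : ¬(p = 3 ∧ ∃ k : ℕ, n = 5 * 3 ^ k))
    {ι : Type*} [Finite ι] (k : ι → Type*) [∀ i, Field (k i)] [∀ i, Finite (k i)]
    [∀ i, CharP (k i) p] (f : ∀ i, Oring ζ →+* k i) (hf : ∀ i, Function.Surjective (f i))
    (hker : ∀ i j, i ≠ j → ∀ φ : k i →+* k j, φ.comp (f i) ≠ f j) (m : ∀ i, SL(2, k i)) :
    ∃ d ∈ Delta ζ, ∀ i, Matrix.SpecialLinearGroup.map (f i) d = m i := by
  let ρ : ∀ i, Delta ζ →* SL(2, k i) := fun i =>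
    (Matrix.SpecialLinearGroup.map (f i)).comp (Delta ζ).subtype
  let T : Delta ζ := ⟨Tmat ζ, Subgroup.subset_closure (by simp)⟩
  let U : Delta ζ := ⟨Umat ζ, Subgroup.subset_closure (by simp)⟩
  have hT : ∀ i, ρ i T = Em (2 + f i (lamO ζ)) := by
    intro i
    apply sl_ext
    · change f i 1 = 1; simp
    · change f i (2 + lamO ζ) = 2 + f i (lamO ζ)
      rw [← one_add_one_eq_two, ← one_add_one_eq_two, map_add, map_add, map_one]
    · change f i 0 = 0; simp
    · change f i 1 = 1; simp
  have hU : ∀ i, ρ i (U ^ (p - 1)) = Lm 1 := by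
    intro i
    have hodd := hp.out.odd_of_ne_two hp2
    obtain ⟨j, hj⟩ := hodd
    have hpj : p - 1 = 2 * j := by omega
    have u00 : (ρ i U) 0 0 = -1 := by change f i (-1) = -1; simp
    have u01 : (ρ i U) 0 1 = 0 := by change f i 0 = 0; simp
    have u10 : (ρ i U) 1 0 = 1 := by change f i 1 = 1; simp
    have u11 : (ρ i U) 1 1 = -1 := by change f i (-1) = -1; simp
    have hsq : ρ i U * ρ i U = Lm (-2) := by
      apply sl_ext <;> simp only [sl_mul, u00, u01, u10, u11, Lm_00, Lm_01, Lm_10, Lm_11] <;> ring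
    rw [hpj, map_pow, pow_mul, pow_two, hsq, Lm_pow]
    congr 1
    have h0 : ((p : ℕ) : k i) = 0 := CharP.cast_eq_zero (k i) p
    rw [hj] at h0
    push_cast at h0
    linear_combination - h0
  have ha : ∀ i, 2 + f i (lamO ζ) ≠ 0 := fun i => a_ne_zero n hn ζ hζ p hp2 (f i) h1
  have hs : ∀ i, Function.Surjective (ρ i) := by
    intro i
    rw [← MonoidHom.range_eq_top]
    refine sl2_top p hp2 _ (2 + f i (lamO ζ)) (ha i) ?_ ⟨T, hT i⟩ ⟨_, hU i⟩
      (a_sq_ne n hn ζ hζ p (f i) h2)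
    intro K hK
    have hl : lamO ζ ∈ K.comap (f i) := by
      rw [Subring.mem_comap]
      have := K.sub_mem hK (K.add_mem K.one_mem K.one_mem)
      convert! this using 1
      ring
    have := O_top ζ _ hl
    rw [eq_top_iff]
    rintro x -
    obtain ⟨y, rfl⟩ := hf i x
    have hy : y ∈ K.comap (f i) := by rw [this]; trivial
    exact hy
  have hno : ∀ i j, i ≠ j → ∀ φ : k i →+* k j, φ (2 + f i (lamO ζ)) ≠ 2 + f j (lamO ζ) := by
    intro i j hij φ hφ
    apply hker i j hij φ
    apply O_hom_ext
    rw [map_add, map_ofNat] at hφ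
    exact add_left_cancel hφ
  have hbig : ∀ i j, i ≠ j → 3 < Nat.card (k i) := fun i j hij =>
    card_gt n hn ζ hζ p hp2 (f i) (f j) h1 (hno i j hij)
  obtain ⟨d, hd⟩ := product_lemma ρ hs hbig (fun i j hij m =>
    pair_lemma p hp2 (hbig j i hij.symm) (ρ j) (ρ i) (hs j) (hs i) T (U ^ (p - 1)) _ _ (ha j) (ha i)
      (hT j) (hT i) (hU j) (hU i) (hno j i hij.symm) m) m
  exact ⟨d, d.2, hd⟩

theorem O_finite (n : ℕ) (hn : 3 ≤ n) (ζ : ℂ) (hζ : IsPrimitiveRoot ζ n) :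
    Module.Finite ℤ (Oring ζ) := by
  have h1 : IsIntegral ℤ ζ := hζ.isIntegral (by omega)
  have h2 : IsIntegral ℤ ζ⁻¹ := hζ.inv.isIntegral (by omega)
  exact Module.Finite.iff_fg.mpr (h1.add h2).fg_adjoin_singleton

theorem quot_finite (R : Type*) [CommRing R] [Module.Finite ℤ R] (p : ℕ) (hp : p ≠ 0) (I : Ideal R)
    (hI : (p : R) ∈ I) : Finite (R ⧸ I) := by
  have : Module.Finite ℤ (R ⧸ I) :=
    Module.Finite.of_surjective (Ideal.Quotient.mk I).toIntAlgHom.toLinearMap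
      Ideal.Quotient.mk_surjective
  apply Module.finite_of_fg_torsion
  intro x
  refine ⟨⟨(p : ℤ), mem_nonZeroDivisors_of_ne_zero (by exact_mod_cast hp)⟩, ?_⟩
  obtain ⟨y, rfl⟩ := Ideal.Quotient.mk_surjective x
  change (p : ℤ) • (Ideal.Quotient.mk I y) = 0
  rw [zsmul_eq_mul]
  have : Ideal.Quotient.mk I (p : R) = 0 := Ideal.Quotient.eq_zero_iff_mem.2 hI
  rw [map_natCast] at this
  rw [Int.cast_natCast, this, zero_mul]

theorem primes_finite (R : Type*) [CommRing R] (p : R) [Finite (R ⧸ Ideal.span {p})] :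
    Finite {P : Ideal R // P.IsPrime ∧ p ∈ P} := by
  have : Finite (Ideal (R ⧸ Ideal.span {p})) :=
    Finite.of_injective (fun I => (I : Set (R ⧸ Ideal.span {p}))) SetLike.coe_injective
  refine Finite.of_injective
    (fun P : {P : Ideal R // P.IsPrime ∧ p ∈ P} => P.1.map (Ideal.Quotient.mk (Ideal.span {p}))) ?_
  intro P Q h
  have key : ∀ P : {P : Ideal R // P.IsPrime ∧ p ∈ P},
      (P.1.map (Ideal.Quotient.mk (Ideal.span {p}))).comap (Ideal.Quotient.mk (Ideal.span {p}))
        = P.1 := by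
    intro P
    rw [Ideal.comap_map_of_surjective _ Ideal.Quotient.mk_surjective, ← RingHom.ker_eq_comap_bot,
      Ideal.mk_ker, sup_eq_left, Ideal.span_singleton_le_iff_mem]
    exact P.2.2
  apply Subtype.ext
  rw [← key P, ← key Q]
  exact congrArg _ h

theorem surjective_mod_radical
    (n : ℕ) (hn : 3 ≤ n) (ζ : ℂ) (hζ : IsPrimitiveRoot ζ n)
    (p : ℕ) (hp : p.Prime) (hpodd : Odd p)
    (h1 : ∀ k : ℕ, 1 ≤ k → n ≠ 2 * p ^ k)
    (h2 : ¬(p = 3 ∧ ∃ k : ℕ, n = 5 * 3 ^ k)) :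
    (Delta ζ).map (SLred ζ (Ideal.span {(p : Oring ζ)}).radical) = ⊤ := by
  have : Fact p.Prime := ⟨hp⟩
  have hp2 : p ≠ 2 := by rintro rfl; exact absurd hpodd (by decide)
  have := O_finite n hn ζ hζ
  have := quot_finite (Oring ζ) p hp.ne_zero (Ideal.span {(p : Oring ζ)})
    (Ideal.mem_span_singleton_self _)
  set J := (Ideal.span {(p : Oring ζ)}).radical with hJ
  let ι := {P : Ideal (Oring ζ) // P.IsPrime ∧ (p : Oring ζ) ∈ P}
  have : Finite ι := primes_finite (Oring ζ) (p : Oring ζ)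
  have hfin : ∀ i : ι, Finite (Oring ζ ⧸ i.1) := fun i => quot_finite _ p hp.ne_zero _ i.2.2
  have hmax : ∀ i : ι, i.1.IsMaximal := fun i => by
    have := i.2.1
    exact Ideal.Quotient.maximal_of_isField _ (Finite.isField_of_domain _)
  have hle : ∀ i : ι, J ≤ i.1 := fun i => by
    rw [hJ, i.2.1.radical_le_iff, Ideal.span_singleton_le_iff_mem]
    exact i.2.2
  let _ : ∀ i : ι, Field (Oring ζ ⧸ i.1) := fun i => Ideal.Quotient.field i.1
  have hch : ∀ i : ι, CharP (Oring ζ ⧸ i.1) p := fun i => by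
    rw [CharP.charP_iff_prime_eq_zero hp]
    have : Ideal.Quotient.mk i.1 (p : Oring ζ) = 0 := Ideal.Quotient.eq_zero_iff_mem.2 i.2.2
    rwa [map_natCast] at this
  rw [eq_top_iff]
  rintro M -
  obtain ⟨d, hd, hdm⟩ := family_surj n hn ζ hζ p hp2 h1 h2 (fun i : ι => Oring ζ ⧸ i.1)
    (fun i => Ideal.Quotient.mk i.1) (fun i => Ideal.Quotient.mk_surjective)
    (by
      intro i j hij φ hφ
      apply hij
      apply Subtype.ext
      refine (hmax i).eq_of_le (hmax j).ne_top fun x hx => ?_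
      rw [← Ideal.Quotient.eq_zero_iff_mem] at hx ⊢
      have := congrArg (fun g => g x) hφ
      simp only [RingHom.comp_apply] at this
      rw [← this]
      exact (congrArg φ hx).trans (map_zero φ))
    (fun i => Matrix.SpecialLinearGroup.map (Ideal.Quotient.factor (hle i)) M)
  refine ⟨d, hd, ?_⟩
  have key : ∀ a b : Fin 2, (SLred ζ J d) a b = M a b := by
    intro a b
    obtain ⟨x, hx⟩ := Ideal.Quotient.mk_surjective (M a b)
    rw [← hx]
    change Ideal.Quotient.mk J (d a b) = Ideal.Quotient.mk J x
    rw [Ideal.Quotient.eq, hJ, Ideal.radical_eq_sInf, Submodule.mem_sInf]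
    rintro P ⟨hP1, hP2⟩
    let i : ι := ⟨P, hP2, hP1 (Ideal.mem_span_singleton_self _)⟩
    have := congrArg (fun g => g a b) (hdm i)
    have h : Ideal.Quotient.mk P (d a b) = Ideal.Quotient.factor (hle i) (M a b) := this
    rw [← hx, Ideal.Quotient.factor_mk] at h
    exact Ideal.Quotient.eq.1 h
  exact sl_ext (key 0 0) (key 0 1) (key 1 0) (key 1 1)

end
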